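/- For every positive integer k there exists ε > 0 such that for infinitely many integers n there exists a (2,1)-type 3-uniform hypergraph H with respect to a vertex partition V(H) = A ∪ B with |A| = |B| = n satisfying: (C1) d_H({a₁,a₂}) ≥ εn for any two distinct vertices a₁,a₂ ∈ A; (C2) d_H({a,b}) ≥ εn for every a ∈ A and b ∈ B; and (C3) H contains no copy of any 3-graph F with at most k vertices and π_⋅(F) > 0. -/

import Mathlib

open Filter

/-- A 3-uniform hypergraph on vertex type `V`: a set of edges, each of size 3. -/
structure H3 (V : Type) [DecidableEq V] where
  edges : Finset (Finset V)
  card3 : ∀ e ∈ edges, e.card = 3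

namespace H3

variable {V W : Type} [DecidableEq V] [DecidableEq W]

/-- `H` contains a copy of `F`: an injection of vertices mapping edges to edges. -/
def contains (H : H3 V) (F : H3 W) : Prop :=
  ∃ f : W → V, Function.Injective f ∧ ∀ e ∈ F.edges, e.image f ∈ H.edges

/-- `H` is `F`-free. -/
def free (H : H3 V) (F : H3 W) : Prop := ¬ H.contains F

/-- The codegree of a pair of vertices: the number of edges containing both. -/
def codeg (H : H3 V) (u v : V) : ℕ :=
  (H.edges.filter fun e => u ∈ e ∧ v ∈ e).card

/-- The minimum codegree: the minimum of `codeg` over pairs of distinct vertices. -/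
noncomputable def minCodeg [Fintype V] (H : H3 V) : ℕ :=
  sInf {d | ∃ u v : V, u ≠ v ∧ H.codeg u v = d}

/-- `H` is uniformly `(d, η)`-dense: every vertex subset `U` spans at least
`d * C(|U|,3) - η * n^3` edges. -/
def uniformlyDense [Fintype V] (H : H3 V) (d η : ℝ) : Prop :=
  ∀ U : Finset V,
    d * (U.card.choose 3 : ℝ) - η * (Fintype.card V : ℝ) ^ 3
      ≤ ((H.edges.filter fun e => e ⊆ U).card : ℝ)

end H3

/-- The uniform Turán density `π_⋅(F)`. -/
noncomputable def uniformTuranDensity {W : Type} [DecidableEq W] (F : H3 W) : ℝ :=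
  sSup {d : ℝ | 0 ≤ d ∧ d ≤ 1 ∧
    ∀ η : ℝ, 0 < η → ∀ n₀ : ℕ, ∃ n, n₀ ≤ n ∧
      ∃ H : H3 (Fin n), H.free F ∧ H.uniformlyDense d η}

/-- The codegree Turán number `ex_co(n, F)`: the maximum minimum codegree of an
`n`-vertex `F`-free 3-graph. -/
noncomputable def exCodeg {W : Type} [DecidableEq W] (n : ℕ) (F : H3 W) : ℕ :=
  sSup {d | ∃ H : H3 (Fin n), H.free F ∧ H.minCodeg = d}

/-- The codegree Turán density `π_co(F) = lim_n ex_co(n,F)/n` (the limit exists,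
so it coincides with the limsup). -/
noncomputable def codegTuranDensity {W : Type} [DecidableEq W] (F : H3 W) : ℝ :=
  Filter.limsup (fun n : ℕ => (exCodeg n F : ℝ) / n) Filter.atTop

/-- The increasing map `ℕ → ℕ` whose range misses exactly `p`. -/
def skip (p i : ℕ) : ℕ := if i < p then i else i + 1

/-- Transport of a set of pairs along a map of indices. -/
def mapPairs (σ : ℕ → ℕ) (S : Finset (ℕ × ℕ)) : Finset (ℕ × ℕ) := S.image (Prod.map σ σ)

theorem mapPairs_mapPairs (σ τ : ℕ → ℕ) (S : Finset (ℕ × ℕ)) :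
    mapPairs σ (mapPairs τ S) = mapPairs (σ ∘ τ) S := by
  simp [mapPairs, Finset.image_image, Prod.map_comp_map]

theorem mapPairs_union (σ : ℕ → ℕ) (S S' : Finset (ℕ × ℕ)) :
    mapPairs σ (S ∪ S') = mapPairs σ S ∪ mapPairs σ S' := by
  simp [mapPairs, Finset.image_union]

theorem mapPairs_congr {σ τ : ℕ → ℕ} {S : Finset (ℕ × ℕ)}
    (h : ∀ p ∈ S, σ p.1 = τ p.1 ∧ σ p.2 = τ p.2) : mapPairs σ S = mapPairs τ S := by
  refine Finset.image_congr fun p hp => ?_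
  simp [Prod.map, h p hp]

/-- The abstract properties of `S ↦ ℙ(⋂ (i,j) ∈ S, N i j)` for a spreadable array of events. -/
structure SpreadableGram (e : Finset (ℕ × ℕ) → ℝ) : Prop where
  empty : e ∅ = 1
  le_one : ∀ S, e S ≤ 1
  anti : ∀ S S', S ⊆ S' → e S' ≤ e S
  skip : ∀ p S, e (mapPairs (skip p) S) = e S
  psd : ∀ {ι : Type} [Fintype ι] (F : ι → Finset (ℕ × ℕ)) (α : ι → ℝ),
    0 ≤ ∑ s, ∑ t, α s * α t * e (F s ∪ F t)

namespace SpreadableGram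

variable {e : Finset (ℕ × ℕ) → ℝ}

theorem mapPairs_eq_of_lt (he : SpreadableGram e) (n : ℕ) (S : Finset (ℕ × ℕ))
    (hS : ∀ p ∈ S, p.1 < n ∧ p.2 < n) (d : ℕ) :
    ∀ σ : ℕ → ℕ, StrictMono σ → σ n ≤ n + d → e (mapPairs σ S) = e S := by
  induction d with
  | zero =>
    intro σ hσ hd
    have hid : ∀ i ≤ n, σ i = i := by
      intro i hi
      have h1 := hσ.le_apply (x := i)
      have h2 := hσ.add_le_nat (n - i) i
      rw [Nat.sub_add_cancel hi] at h2
      lia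
    rw [mapPairs_congr (τ := id) (fun p hp => ⟨hid _ (hS p hp).1.le, hid _ (hS p hp).2.le⟩)]
    simp [mapPairs]
  | succ d ih =>
    intro σ hσ hd
    by_cases hid : ∀ i ≤ n, σ i = i
    · exact ih σ hσ (by rw [hid n le_rfl]; lia)
    · push Not at hid
      have hex : ∃ i, i ≤ n ∧ σ i ≠ i := hid
      obtain ⟨hpn, hp⟩ := Nat.find_spec hex
      have hmin : ∀ i < Nat.find hex, i ≤ n → σ i = i := fun i hi hin => by
        by_contra h
        exact Nat.find_min hex hi ⟨hin, h⟩
      set p := Nat.find hex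
      have hpp : p < σ p := lt_of_le_of_ne hσ.le_apply (Ne.symm hp)
      have hge : ∀ i, p ≤ i → p < σ i := fun i hi => hpp.trans_le (hσ.monotone hi)
      have hlt : ∀ i < p, σ i = i := fun i hi => hmin i hi (by lia)
      set τ : ℕ → ℕ := fun i => if i < p then i else σ i - 1 with hτ
      have hτm : StrictMono τ := by
        intro i j hij
        have := hσ hij
        have h1 := hge i
        have h2 := hge j
        simp only [hτ]
        split_ifs <;> lia
      have hcomp : σ = _root_.skip p ∘ τ := by
        funext i
        simp only [Function.comp, _root_.skip, hτ]
        have h1 := hge i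
        have h2 := hlt i
        split_ifs <;> lia
      rw [hcomp, ← mapPairs_mapPairs, he.skip]
      refine ih τ hτm ?_
      have := hge n hpn
      simp only [hτ]
      split_ifs <;> lia

theorem mapPairs_eq (he : SpreadableGram e) (S : Finset (ℕ × ℕ)) {σ : ℕ → ℕ}
    (hσ : StrictMono σ) : e (mapPairs σ S) = e S := by
  let n := (S.sup fun p => max p.1 p.2) + 1
  refine he.mapPairs_eq_of_lt n S (fun p hp => ?_) (σ n) σ hσ (by lia)
  have : max p.1 p.2 ≤ S.sup fun p => max p.1 p.2 :=
    Finset.le_sup (f := fun p : ℕ × ℕ => max p.1 p.2) hp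
  simp only [n]
  lia

/-- Move position `q` to `q + s` inside a gap of length `n` opened after it. -/
def stretch (q n s i : ℕ) : ℕ := if i < q then i else if i = q then q + s else i + n

/-- Move the positions `q` and `q + 1` to `q + s` and `q + t` inside a gap of length `n`. -/
def stretchPair (q n s t i : ℕ) : ℕ :=
  if i < q then i else if i = q then q + s else if i = q + 1 then q + t else i - 1 + n

theorem stretch_strictMono {q n s : ℕ} (h : s ≤ n) : StrictMono (stretch q n s) := by
  intro i j hij
  simp only [stretch]
  split_ifs <;> lia

theorem stretchPair_strictMono {q n s t : ℕ} (h : s < t) (h' : t ≤ n) :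
    StrictMono (stretchPair q n s t) := by
  intro i j hij
  simp only [stretchPair]
  split_ifs <;> lia

theorem stretch_union_eq (he : SpreadableGram e) {q n s t : ℕ} (h : s < t) (h' : t ≤ n)
    (S S' : Finset (ℕ × ℕ)) :
    e (mapPairs (stretch q n s) S ∪ mapPairs (stretch q n t) S') =
      e (mapPairs (_root_.skip (q + 1)) S ∪ mapPairs (_root_.skip q) S') := by
  refine Eq.trans ?_ (he.mapPairs_eq _ (stretchPair_strictMono (q := q) h h'))
  rw [mapPairs_union, mapPairs_mapPairs, mapPairs_mapPairs]
  congr 3 <;> funext i <;> simp only [Function.comp, stretch, stretchPair, _root_.skip] <;>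
    split_ifs <;> lia

/-- Inserting a twin of position `q` at most squares the value. -/
theorem sq_le_double (he : SpreadableGram e) (q : ℕ) (S : Finset (ℕ × ℕ)) :
    e S ^ 2 ≤ e (mapPairs (_root_.skip (q + 1)) S ∪ mapPairs (_root_.skip q) S) := by
  set C := e (mapPairs (_root_.skip (q + 1)) S ∪ mapPairs (_root_.skip q) S) with hC
  have key : ∀ n : ℕ, 0 < n → (n : ℝ) * (e S ^ 2 - C) ≤ 1 - C := by
    intro n hn
    have hpsd := he.psd (ι := Fin n ⊕ Unit)
      (Sum.elim (fun s => mapPairs (stretch q n s) S) fun _ => ∅)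
      (Sum.elim (fun _ => 1) fun _ => -(n * e S))
    have h1 : ∀ s : Fin n, e (mapPairs (stretch q n s) S) = e S :=
      fun s => he.mapPairs_eq _ (stretch_strictMono s.2.le)
    have h2 : ∀ s t : Fin n, e (mapPairs (stretch q n s) S ∪ mapPairs (stretch q n t) S) ≤
        C + if s = t then 1 - C else 0 := by
      intro s t
      rcases lt_trichotomy s t with h | h | h
      · rw [he.stretch_union_eq h t.2.le, if_neg h.ne]; simp [hC]
      · subst h; simpa using he.le_one _
      · rw [Finset.union_comm, he.stretch_union_eq h s.2.le, if_neg h.ne']; simp [hC]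
    have h3 : ∑ s : Fin n, ∑ t : Fin n,
        e (mapPairs (stretch q n s) S ∪ mapPairs (stretch q n t) S) ≤
          n * (n * C) + n * (1 - C) := by
      refine (Finset.sum_le_sum fun s _ => Finset.sum_le_sum fun t _ => h2 s t).trans ?_
      simp [Finset.sum_add_distrib]
    simp only [Fintype.sum_sum_type, Sum.elim_inl, Sum.elim_inr, Finset.union_empty,
      Finset.empty_union, h1, he.empty, Finset.sum_add_distrib, Finset.univ_unique,
      Finset.sum_const, Finset.card_univ, Finset.card_singleton, Nat.cast_one, mul_one,
      Fintype.card_fin, one_mul,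
      nsmul_eq_mul] at hpsd
    have hn' : (0 : ℝ) < n := by exact_mod_cast hn
    have : (n : ℝ) * (n * (e S ^ 2 - C)) ≤ n * (1 - C) := by nlinarith
    exact le_of_mul_le_mul_left this hn'
  by_contra! hlt
  obtain ⟨n, hn⟩ := exists_nat_gt ((1 - C) / (e S ^ 2 - C))
  have hpos : 0 < e S ^ 2 - C := by linarith
  rw [div_lt_iff₀ hpos] at hn
  have h1 : 0 ≤ 1 - C := sub_nonneg.2 (he.le_one _)
  have := key n (Nat.pos_of_ne_zero fun h0 => by subst h0; simp at hn; linarith)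
  linarith

/-- Adjacent positions which do not interact may be exchanged. -/
theorem swap_eq (he : SpreadableGram e) (q : ℕ) (S S' : Finset (ℕ × ℕ)) :
    e (mapPairs (_root_.skip (q + 1)) S ∪ mapPairs (_root_.skip q) S') =
      e (mapPairs (_root_.skip q) S ∪ mapPairs (_root_.skip (q + 1)) S') := by
  set A := e (mapPairs (_root_.skip (q + 1)) S ∪ mapPairs (_root_.skip q) S') with hA
  set B := e (mapPairs (_root_.skip q) S ∪ mapPairs (_root_.skip (q + 1)) S') with hB
  set C := e (mapPairs (_root_.skip (q + 1)) S ∪ mapPairs (_root_.skip q) S) with hC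
  have hC0 : 0 ≤ C := (sq_nonneg _).trans (he.sq_le_double q S)
  have key : ∀ n : ℕ, 0 < n → (n : ℝ) * (A - B) ^ 2 ≤ 2 := by
    intro n hn
    let a : ℕ → Finset (ℕ × ℕ) := fun s => mapPairs (stretch q (2 * n) s) S
    let g := mapPairs (stretch q (2 * n) n) S'
    have hpsd := he.psd (ι := Fin n ⊕ Fin n ⊕ Unit)
      (Sum.elim (fun s => a s) (Sum.elim (fun s => a (n + 1 + s)) fun _ => g))
      (Sum.elim (fun _ => 1) (Sum.elim (fun _ => -1) fun _ => -(n * (A - B))))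
    have haC : ∀ s t : ℕ, s < t → t ≤ 2 * n → e (a s ∪ a t) = C :=
      fun s t h h' => he.stretch_union_eq h h' S S
    have haC' : ∀ s t : ℕ, t < s → s ≤ 2 * n → e (a s ∪ a t) = C := fun s t h h' => by
      rw [Finset.union_comm]; exact haC t s h h'
    have hdiag : ∀ k, k + n ≤ 2 * n + 1 → ∑ s : Fin n, ∑ t : Fin n, e (a (k + s) ∪ a (k + t)) ≤
        n * (n * C) + n * (1 - C) := by
      intro k hk
      have : ∀ s t : Fin n, e (a (k + s) ∪ a (k + t)) ≤ C + if s = t then 1 - C else 0 := by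
        intro s t
        rcases lt_trichotomy s t with h | h | h
        · rw [haC _ _ (by simpa using h) (by lia), if_neg h.ne]; simp
        · subst h; simpa using he.le_one _
        · rw [haC' _ _ (by simpa using h) (by lia), if_neg h.ne']; simp
      refine (Finset.sum_le_sum fun s _ => Finset.sum_le_sum fun t _ => this s t).trans ?_
      simp [Finset.sum_add_distrib]
    have h1 := hdiag 0 (by lia)
    simp only [zero_add] at h1
    have h2 := hdiag (n + 1) (by lia)
    have h3 : ∀ s t : Fin n, e (a s ∪ a (n + 1 + t)) = C :=
      fun s t => haC _ _ (by lia) (by lia)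
    have h3' : ∀ s t : Fin n, e (a (n + 1 + s) ∪ a t) = C :=
      fun s t => haC' _ _ (by lia) (by lia)
    have h4 : ∀ s : Fin n, e (a s ∪ g) = A := fun s => he.stretch_union_eq s.2 (by lia) S S'
    have h5 : ∀ s : Fin n, e (a (n + 1 + s) ∪ g) = B := fun s => by
      rw [Finset.union_comm, hB, Finset.union_comm (mapPairs (_root_.skip q) S)]
      exact he.stretch_union_eq (by lia) (by lia) S' S
    have h4' : ∀ s : Fin n, e (g ∪ a s) = A := fun s => by rw [Finset.union_comm, h4]
    have h5' : ∀ s : Fin n, e (g ∪ a (n + 1 + s)) = B := fun s => by rw [Finset.union_comm, h5]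
    have h6 : e (g ∪ g) ≤ 1 := he.le_one _
    simp only [Fintype.sum_sum_type, Sum.elim_inl, Sum.elim_inr, h3, h3', h4, h5, h4', h5',
      Finset.sum_add_distrib, Finset.univ_unique,
      Finset.sum_const, Finset.card_univ, Finset.card_singleton, Nat.cast_one, mul_one,
      Fintype.card_fin, one_mul,
      neg_mul, mul_neg, Finset.sum_neg_distrib,
      nsmul_eq_mul] at hpsd
    have hn' : (0 : ℝ) < n := by exact_mod_cast hn
    have h7 : (n * (A - B)) * (n * (A - B)) * e (g ∪ g) ≤ (n * (A - B)) * (n * (A - B)) * 1 :=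
      mul_le_mul_of_nonneg_left h6 (mul_self_nonneg _)
    have : (n : ℝ) * (n * (A - B) ^ 2) ≤ n * 2 := by nlinarith
    exact le_of_mul_le_mul_left this hn'
  by_contra hne
  have hpos : 0 < (A - B) ^ 2 := by have := sub_ne_zero.2 hne; positivity
  obtain ⟨n, hn⟩ := exists_nat_gt (2 / (A - B) ^ 2)
  rw [div_lt_iff₀ hpos] at hn
  have := key n (Nat.pos_of_ne_zero fun h0 => by subst h0; simp at hn; linarith)
  linarith

end SpreadableGram

/-- The pairs `i < j < n` coloured `false, true`. -/
def bichromaticPairs (n : ℕ) (c : ℕ → Bool) : Finset (ℕ × ℕ) :=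
  (Finset.range n ×ˢ Finset.range n).filter fun p => p.1 < p.2 ∧ c p.1 = false ∧ c p.2 = true

theorem mem_bichromaticPairs {n : ℕ} {c : ℕ → Bool} {p : ℕ × ℕ} :
    p ∈ bichromaticPairs n c ↔ p.1 < p.2 ∧ p.2 < n ∧ c p.1 = false ∧ c p.2 = true := by
  simp only [bichromaticPairs, Finset.mem_filter, Finset.mem_product, Finset.mem_range]
  constructor
  · tauto
  · rintro ⟨h, h', h''⟩
    exact ⟨⟨h.trans h', h'⟩, h, h''⟩

theorem mapPairs_skip_subset {n : ℕ} (c : ℕ → Bool) (p : ℕ) :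
    mapPairs (skip p) (bichromaticPairs n (c ∘ skip p)) ⊆ bichromaticPairs (n + 1) c := by
  intro x hx
  simp only [mapPairs, Finset.mem_image, mem_bichromaticPairs, Function.comp] at hx
  obtain ⟨y, ⟨h1, h2, h3, h4⟩, rfl⟩ := hx
  refine mem_bichromaticPairs.2 ⟨?_, ?_, h3, h4⟩ <;> simp only [Prod.map, skip] <;>
    split_ifs <;> lia

theorem mem_mapPairs_skip {n : ℕ} {c : ℕ → Bool} {p : ℕ} (hp : p ≤ n) {x : ℕ × ℕ}
    (hx : x ∈ bichromaticPairs (n + 1) c) (h1 : x.1 ≠ p) (h2 : x.2 ≠ p) :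
    x ∈ mapPairs (skip p) (bichromaticPairs n (c ∘ skip p)) := by
  obtain ⟨h3, h4, h5, h6⟩ := mem_bichromaticPairs.1 hx
  have hs : ∀ i, i ≠ p → skip p (if i < p then i else i - 1) = i := by
    intro i hi
    simp only [skip]
    split_ifs <;> lia
  refine Finset.mem_image.2
    ⟨(if x.1 < p then x.1 else x.1 - 1, if x.2 < p then x.2 else x.2 - 1), ?_, ?_⟩
  · refine mem_bichromaticPairs.2 ⟨?_, ?_, ?_, ?_⟩
    · dsimp only
      split_ifs <;> lia
    · dsimp only
      split_ifs <;> lia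
    · simpa only [Function.comp, hs _ h1] using h5
    · simpa only [Function.comp, hs _ h2] using h6
  · simp only [Prod.map, hs _ h1, hs _ h2]

namespace SpreadableGram

variable {e : Finset (ℕ × ℕ) → ℝ}

theorem bichromaticPairs_pos_of_eq (he : SpreadableGram e) {n q : ℕ} {c : ℕ → Bool}
    (hc : c q = c (q + 1)) (h : 0 < e (bichromaticPairs n (c ∘ _root_.skip q))) (hq : q < n) :
    0 < e (bichromaticPairs (n + 1) c) := by
  refine (pow_pos h 2).trans_le ((he.sq_le_double q _).trans (he.anti _ _ fun x hx => ?_))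
  have hcc : c ∘ _root_.skip q = c ∘ _root_.skip (q + 1) := by
    funext i
    simp only [Function.comp, _root_.skip]
    rcases lt_trichotomy i q with h | rfl | h
    · rw [if_pos h, if_pos (by lia)]
    · simp [hc]
    · rw [if_neg (by lia), if_neg (by lia)]
  obtain ⟨h1, h2, h3, h4⟩ := mem_bichromaticPairs.1 hx
  by_cases hxq : x.1 ≠ q ∧ x.2 ≠ q
  · exact Finset.mem_union_right _ (mem_mapPairs_skip hq.le hx hxq.1 hxq.2)
  · rw [hcc]
    refine Finset.mem_union_left _ (mem_mapPairs_skip hq hx ?_ ?_) <;> intro hx'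
    · have : x.2 = q := by lia
      lia
    · rcases eq_or_ne x.1 q with h | h
      · rw [h] at h3
        rw [hx', ← hc, h3] at h4
        cases h4
      · have : x.2 = q := by tauto
        lia

theorem bichromaticPairs_swap_le (he : SpreadableGram e) {n q : ℕ} {c c' : ℕ → Bool}
    (hq : q < n) (h0 : c q = true) (h1 : c (q + 1) = false) (h0' : c' q = false)
    (h1' : c' (q + 1) = true) (h : ∀ i, i ≠ q → i ≠ q + 1 → c i = c' i) :
    e (bichromaticPairs (n + 1) c') ≤ e (bichromaticPairs (n + 1) c) := by
  have hc : c ∘ _root_.skip (q + 1) = c' ∘ _root_.skip q := by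
    funext i
    simp only [Function.comp, _root_.skip]
    rcases lt_trichotomy i q with h2 | rfl | h2
    · rw [if_pos h2, if_pos (by lia), h _ (by lia) (by lia)]
    · simp [h0, h1']
    · rw [if_neg (by lia), if_neg (by lia), h _ (by lia) (by lia)]
  have hc' : c ∘ _root_.skip q = c' ∘ _root_.skip (q + 1) := by
    funext i
    simp only [Function.comp, _root_.skip]
    rcases lt_trichotomy i q with h2 | rfl | h2
    · rw [if_pos h2, if_pos (by lia), h _ (by lia) (by lia)]
    · simp [h1, h0']
    · rw [if_neg (by lia), if_neg (by lia), h _ (by lia) (by lia)]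
  calc e (bichromaticPairs (n + 1) c')
      ≤ e (mapPairs (_root_.skip q) (bichromaticPairs n (c' ∘ _root_.skip q)) ∪
          mapPairs (_root_.skip (q + 1)) (bichromaticPairs n (c' ∘ _root_.skip (q + 1)))) :=
        he.anti _ _ (Finset.union_subset (mapPairs_skip_subset _ _) (mapPairs_skip_subset _ _))
    _ = e (mapPairs (_root_.skip (q + 1)) (bichromaticPairs n (c ∘ _root_.skip (q + 1))) ∪
          mapPairs (_root_.skip q) (bichromaticPairs n (c ∘ _root_.skip q))) := by
        rw [hc, hc', he.swap_eq]
    _ ≤ e (bichromaticPairs (n + 1) c) := by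
        refine he.anti _ _ fun x hx => ?_
        obtain ⟨h2, h3, h4, h5⟩ := mem_bichromaticPairs.1 hx
        by_cases hxq : x.1 ≠ q ∧ x.2 ≠ q
        · exact Finset.mem_union_right _ (mem_mapPairs_skip hq.le hx hxq.1 hxq.2)
        · refine Finset.mem_union_left _ (mem_mapPairs_skip hq hx ?_ ?_) <;> intro hx'
          · have : x.2 = q := by lia
            lia
          · rw [hx', h1] at h5
            cases h5

theorem bichromaticPairs_pos (he : SpreadableGram e) (h : 0 < e {(0, 1)}) (n : ℕ) :
    ∀ c : ℕ → Bool, 0 < e (bichromaticPairs n c) := by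
  induction n with
  | zero => exact fun c => by simp [bichromaticPairs, he.empty]
  | succ n ih =>
    intro c
    match n, ih with
    | 0, _ =>
      have : bichromaticPairs 1 c = ∅ := by
        ext x
        simp only [mem_bichromaticPairs, Finset.notMem_empty, iff_false]
        lia
      rw [this, he.empty]; exact one_pos
    | 1, _ =>
      refine h.trans_le (he.anti _ _ fun x hx => ?_)
      rw [mem_bichromaticPairs] at hx
      rw [Finset.mem_singleton, Prod.ext_iff]
      exact ⟨by lia, by lia⟩
    | n + 2, ih =>
      by_cases h01 : c 0 = c 1
      · exact he.bichromaticPairs_pos_of_eq h01 (ih _) (by lia)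
      by_cases h12 : c 1 = c 2
      · exact he.bichromaticPairs_pos_of_eq h12 (ih _) (by lia)
      cases h0 : c 0 with
      | true =>
        have h1 : c 1 = false := by rw [h0] at h01; simpa using Ne.symm h01
        have h2 : c 2 = true := by rw [h1] at h12; simpa using Ne.symm h12
        refine lt_of_lt_of_le ?_ (he.bichromaticPairs_swap_le (q := 0)
          (c' := fun i => if i = 0 then false else if i = 1 then true else c i)
          (by lia) h0 h1 rfl rfl fun i hi hi' => by simp_all)
        exact he.bichromaticPairs_pos_of_eq (q := 1) (by simp [h2]) (ih _) (by lia)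
      | false =>
        have h1 : c 1 = true := by rw [h0] at h01; simpa using Ne.symm h01
        have h2 : c 2 = false := by rw [h1] at h12; simpa using Ne.symm h12
        refine lt_of_lt_of_le ?_ (he.bichromaticPairs_swap_le (q := 1)
          (c' := fun i => if i = 1 then false else if i = 2 then true else c i)
          (by lia) h1 h2 rfl rfl fun i hi hi' => by simp_all)
        exact he.bichromaticPairs_pos_of_eq (q := 0) (by simp [h0]) (ih _) (by lia)

end SpreadableGram

/-- Put `x` in front of the sequence `f`. -/
def consSeq (x : ℕ) (f : ℕ → ℕ) (i : ℕ) : ℕ := if i = 0 then x else f (i - 1)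

/-- The law of `n` indices, each taken at infinity relative to the preceding ones, followed by a
common upper bound at infinity relative to all of them. -/
noncomputable def indexLaw : ℕ → Ultrafilter ((ℕ → ℕ) × ℕ)
  | 0 => (hyperfilter ℕ).map fun M => (fun _ => 0, M)
  | n + 1 => (hyperfilter ℕ).bind fun x => (indexLaw n).map fun p => (consSeq x p.1, p.2)

theorem eventually_indexLaw_succ {n : ℕ} {Q : (ℕ → ℕ) × ℕ → Prop} :
    (∀ᶠ p in (indexLaw (n + 1) : Filter ((ℕ → ℕ) × ℕ)), Q p) ↔
      ∀ᶠ x in (hyperfilter ℕ : Filter ℕ), ∀ᶠ p in (indexLaw n : Filter ((ℕ → ℕ) × ℕ)),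
        Q (consSeq x p.1, p.2) :=
  Iff.rfl

theorem eventually_indexLaw_skip {n q : ℕ} (hq : q ≤ n) :
    ∀ {Q : (ℕ → ℕ) × ℕ → Prop},
      (∀ᶠ p in (indexLaw (n + 1) : Filter ((ℕ → ℕ) × ℕ)), Q (p.1 ∘ skip q, p.2)) ↔
        ∀ᶠ p in (indexLaw n : Filter ((ℕ → ℕ) × ℕ)), Q p := by
  induction n generalizing q with
  | zero =>
    intro Q
    obtain rfl : q = 0 := by lia
    rw [eventually_indexLaw_succ]
    have : ∀ x f, consSeq x f ∘ skip 0 = f := fun x f => by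
      funext i; simp [consSeq, skip]
    simp only [this]
    exact eventually_const
  | succ n ih =>
    intro Q
    rw [eventually_indexLaw_succ]
    rcases Nat.eq_zero_or_pos q with rfl | hq0
    · have : ∀ x f, consSeq x f ∘ skip 0 = f := fun x f => by
        funext i; simp [consSeq, skip]
      simp only [this]
      exact eventually_const
    · have : ∀ x f, consSeq x f ∘ skip q = consSeq x (f ∘ skip (q - 1)) := fun x f => by
        funext i
        simp only [consSeq, skip, Function.comp]
        split_ifs <;> first | rfl | lia | (congr 1; lia)
      simp only [this]
      rw [eventually_indexLaw_succ]
      refine eventually_congr (Eventually.of_forall fun x => ?_)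
      exact ih (q := q - 1) (by lia) (Q := fun p => Q (consSeq x p.1, p.2))

theorem tendsto_indexLaw_skip {n q : ℕ} (hq : q ≤ n) {g : (ℕ → ℕ) × ℕ → ℝ} {L : ℝ} :
    Tendsto (fun p : (ℕ → ℕ) × ℕ => g (p.1 ∘ skip q, p.2)) (indexLaw (n + 1)) (nhds L) ↔
      Tendsto g (indexLaw n) (nhds L) :=
  forall₂_congr fun s _ => eventually_indexLaw_skip hq (Q := fun p => g p ∈ s)

theorem eventually_indexLaw_bounds (n : ℕ) : ∀ K : ℕ,
    ∀ᶠ p in (indexLaw n : Filter ((ℕ → ℕ) × ℕ)), K < p.2 ∧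
      (∀ i < n, K ≤ p.1 i ∧ p.1 i < p.2) ∧ ∀ i j, i < j → j < n → p.1 i < p.1 j := by
  have hat : ∀ K, ∀ᶠ x in (hyperfilter ℕ : Filter ℕ), K < x :=
    fun K => Nat.hyperfilter_le_atTop (eventually_gt_atTop K)
  induction n with
  | zero =>
    intro K
    change ∀ᶠ M in (hyperfilter ℕ : Filter ℕ), _
    filter_upwards [hat K] with M hM
    exact ⟨hM, by simp, by simp⟩
  | succ n ih =>
    intro K
    rw [eventually_indexLaw_succ]
    filter_upwards [hat K] with x hx
    filter_upwards [ih (x + 1)] with p hp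
    obtain ⟨h1, h2, h3⟩ := hp
    refine ⟨by lia, fun i hi => ?_, fun i j hij hj => ?_⟩
    · have := h2 (i - 1)
      simp only [consSeq]
      split_ifs <;> lia
    · have h4 := h2 (j - 1)
      have h5 := h3 (i - 1) (j - 1)
      simp only [consSeq]
      split_ifs <;> lia

open Classical in
/-- The proportion of `b ∈ T` satisfying `N (x i) (x j) b` for all `(i, j) ∈ S`. -/
noncomputable def pairFreq {V : Type} (T : Finset V) (N : ℕ → ℕ → V → Prop) (x : ℕ → ℕ)
    (S : Finset (ℕ × ℕ)) : ℝ :=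
  ((T.filter fun b => ∀ p ∈ S, N (x p.1) (x p.2) b).card : ℝ) / T.card

section pairFreq

variable {V : Type} (T : Finset V) (N : ℕ → ℕ → V → Prop) (x : ℕ → ℕ)

theorem pairFreq_nonneg (S : Finset (ℕ × ℕ)) : 0 ≤ pairFreq T N x S := by
  unfold pairFreq; positivity

theorem pairFreq_le_one (S : Finset (ℕ × ℕ)) : pairFreq T N x S ≤ 1 := by
  classical
  unfold pairFreq
  exact div_le_one_of_le₀ (by exact_mod_cast Finset.card_filter_le _ _) (by positivity)

theorem pairFreq_anti {S S' : Finset (ℕ × ℕ)} (h : S ⊆ S') :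
    pairFreq T N x S' ≤ pairFreq T N x S := by
  classical
  unfold pairFreq
  refine div_le_div_of_nonneg_right ?_ (Nat.cast_nonneg _)
  refine Nat.cast_le.2 (Finset.card_le_card fun b hb => ?_)
  rw [Finset.mem_filter] at hb ⊢
  exact ⟨hb.1, fun p hp => hb.2 p (h hp)⟩

theorem pairFreq_empty (hT : T.Nonempty) : pairFreq T N x ∅ = 1 := by
  have : (T.card : ℝ) ≠ 0 := by exact_mod_cast hT.card_pos.ne'
  simp [pairFreq, this]

theorem pairFreq_mapPairs (σ : ℕ → ℕ) (S : Finset (ℕ × ℕ)) :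
    pairFreq T N x (mapPairs σ S) = pairFreq T N (x ∘ σ) S := by
  classical
  unfold pairFreq
  congr 3
  ext b
  simp only [mapPairs, Finset.mem_filter, Finset.forall_mem_image, Prod.map, Function.comp]

theorem pairFreq_psd {ι : Type} [Fintype ι] (F : ι → Finset (ℕ × ℕ)) (α : ι → ℝ) :
    0 ≤ ∑ s, ∑ t, α s * α t * pairFreq T N x (F s ∪ F t) := by
  classical
  let f : ι → V → ℝ := fun s b => if ∀ p ∈ F s, N (x p.1) (x p.2) b then 1 else 0
  have hf : ∀ s t, pairFreq T N x (F s ∪ F t) = (∑ b ∈ T, f s b * f t b) / T.card := by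
    intro s t
    have : ∀ b, f s b * f t b = if ∀ p ∈ F s ∪ F t, N (x p.1) (x p.2) b then 1 else 0 := by
      intro b
      simp only [f, ite_zero_mul_ite_zero, mul_one, Finset.mem_union, or_imp, forall_and]
    simp only [this, Finset.sum_boole, pairFreq]
  have : ∑ s, ∑ t, α s * α t * pairFreq T N x (F s ∪ F t) =
      (∑ b ∈ T, (∑ s, α s * f s b) ^ 2) / T.card := by
    have hsq : ∀ b, (∑ s, α s * f s b) ^ 2 = ∑ s, ∑ t, α s * α t * (f s b * f t b) := by
      intro b
      rw [sq, Finset.sum_mul_sum]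
      exact Finset.sum_congr rfl fun s _ => Finset.sum_congr rfl fun t _ => by ring
    simp only [hf, hsq, mul_div_assoc', Finset.mul_sum, ← Finset.sum_div]
    congr 1
    rw [Finset.sum_comm (s := T)]
    refine Finset.sum_congr rfl fun s _ => ?_
    rw [Finset.sum_comm (s := T)]
  rw [this]
  positivity

end pairFreq

theorem exists_limit_pairFreq (V : ℕ → Type) (T : ∀ M, Finset (V M))
    (N : ∀ M, ℕ → ℕ → V M → Prop) (hT : ∀ M, (T M).Nonempty) :
    ∃ e : Finset (ℕ × ℕ) → ℝ, SpreadableGram e ∧ ∀ n S, (∀ p ∈ S, p.1 < n ∧ p.2 < n) →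
      Tendsto (fun p : (ℕ → ℕ) × ℕ => pairFreq (T p.2) (N p.2) p.1 S) (indexLaw n)
        (nhds (e S)) := by
  have hlim : ∀ n S, ∃ L, Tendsto
      (fun p : (ℕ → ℕ) × ℕ => pairFreq (T p.2) (N p.2) p.1 S) (indexLaw n) (nhds L) := by
    intro n S
    obtain ⟨L, -, hL⟩ := (isCompact_Icc (a := (0 : ℝ)) (b := 1)).ultrafilter_le_nhds'
      ((indexLaw n).map fun p : (ℕ → ℕ) × ℕ => pairFreq (T p.2) (N p.2) p.1 S)
      (Ultrafilter.mem_map.2 <| Filter.univ_mem'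
        fun p => ⟨pairFreq_nonneg _ _ _ _, pairFreq_le_one _ _ _ _⟩)
    exact ⟨L, hL⟩
  choose L hL using hlim
  let bd : Finset (ℕ × ℕ) → ℕ := fun S => (S.sup fun p => max p.1 p.2) + 1
  have hbd : ∀ S, ∀ p ∈ S, p.1 < bd S ∧ p.2 < bd S := by
    intro S p hp
    have : max p.1 p.2 ≤ S.sup fun p => max p.1 p.2 :=
      Finset.le_sup (f := fun p : ℕ × ℕ => max p.1 p.2) hp
    simp only [bd]
    lia
  have hstep : ∀ n S, (∀ p ∈ S, p.1 < n ∧ p.2 < n) → L (n + 1) S = L n S := by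
    intro n S hS
    refine tendsto_nhds_unique (hL (n + 1) S) ?_
    have h := (tendsto_indexLaw_skip (le_refl n)).2 (hL n S)
    refine h.congr fun p => ?_
    dsimp only
    rw [← pairFreq_mapPairs, mapPairs_congr (τ := id) (S := S)]
    · simp [mapPairs]
    · intro q hq
      simp [skip, hS q hq]
  have hge : ∀ n S, (∀ p ∈ S, p.1 < n ∧ p.2 < n) → ∀ d, L (n + d) S = L n S := by
    intro n S hS d
    induction d with
    | zero => rfl
    | succ d ih =>
      rw [← add_assoc, hstep _ _ fun p hp => ?_, ih]
      have := hS p hp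
      lia
  have heq : ∀ n S, (∀ p ∈ S, p.1 < n ∧ p.2 < n) → L n S = L (bd S) S := by
    intro n S hS
    rw [← hge n S hS (bd S), ← hge _ S (hbd S) n, add_comm]
  have htend : ∀ n S, (∀ p ∈ S, p.1 < n ∧ p.2 < n) →
      Tendsto (fun p : (ℕ → ℕ) × ℕ => pairFreq (T p.2) (N p.2) p.1 S) (indexLaw n)
        (nhds (L (bd S) S)) := fun n S hS => heq n S hS ▸ hL n S
  refine ⟨fun S => L (bd S) S, ⟨?_, ?_, ?_, ?_, ?_⟩, htend⟩
  · refine tendsto_nhds_unique (htend 0 ∅ (by simp)) ?_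
    simp only [pairFreq_empty _ _ _ (hT _)]
    exact tendsto_const_nhds
  · exact fun S => le_of_tendsto (hL _ _)
      (Eventually.of_forall fun p => pairFreq_le_one _ _ _ _)
  · intro S S' h
    exact le_of_tendsto_of_tendsto (htend (bd S') S' (hbd S'))
      (htend (bd S') S fun p hp => hbd S' p (h hp))
      (Eventually.of_forall fun p => pairFreq_anti _ _ _ h)
  · intro q S
    have h1 := htend (bd S + q + 1) (mapPairs (skip q) S) fun p hp => by
      simp only [mapPairs, Finset.mem_image] at hp
      obtain ⟨r, hr, rfl⟩ := hp
      have := hbd S r hr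
      simp only [Prod.map, skip]
      split_ifs <;> lia
    have h2 := htend (bd S + q) S fun p hp => by
      have := hbd S p hp
      lia
    refine tendsto_nhds_unique h1 ?_
    simp only [pairFreq_mapPairs]
    exact (tendsto_indexLaw_skip (Nat.le_add_left q (bd S))).2 h2
  · intro ι _ F α
    let n := ∑ s, ∑ t, bd (F s ∪ F t)
    have hn : ∀ s t, bd (F s ∪ F t) ≤ n := fun s t =>
      (Finset.single_le_sum (f := fun t => bd (F s ∪ F t)) (by simp) (Finset.mem_univ t)).trans
        (Finset.single_le_sum (f := fun s => ∑ t, bd (F s ∪ F t)) (by simp) (Finset.mem_univ s))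
    have h : Tendsto (fun p : (ℕ → ℕ) × ℕ =>
        ∑ s, ∑ t, α s * α t * pairFreq (T p.2) (N p.2) p.1 (F s ∪ F t)) (indexLaw n)
        (nhds (∑ s, ∑ t, α s * α t * L (bd (F s ∪ F t)) (F s ∪ F t))) :=
      tendsto_finsetSum _ fun s _ => tendsto_finsetSum _ fun t _ =>
        (htend n _ fun p hp => by
          have := hbd _ p hp
          have := hn s t
          lia).const_mul _
    exact ge_of_tendsto h (Eventually.of_forall fun p => pairFreq_psd _ _ _ _ _)

open Classical in
/-- A dense array of sets indexed by pairs contains, for long enough index range, a subsequence of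
length `m` realizing every two-colouring with positive density. -/
theorem exists_subseq_realizing_colourings (δ : ℝ) (hδ : 0 < δ) (m : ℕ) :
    ∃ M : ℕ, ∃ τ : ℝ, 0 < τ ∧ ∀ {V : Type} (T : Finset V) (N : ℕ → ℕ → V → Prop), T.Nonempty →
      (∀ i j, i < j → j < M → δ * T.card ≤ ((T.filter fun b => N i j b).card : ℝ)) →
      ∃ x : ℕ → ℕ, (∀ i j, i < j → j < m → x i < x j) ∧ (∀ i < m, x i < M) ∧
        ∀ c : ℕ → Bool, τ * T.card ≤ ((T.filter fun b =>
          ∀ i j, i < j → j < m → c i = false → c j = true → N (x i) (x j) b).card : ℝ) := by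
  by_contra hcon
  push Not at hcon
  choose V T N hT hN hx using fun M : ℕ => hcon M (1 / (M + 1)) (by positivity)
  obtain ⟨e, he, htend⟩ := exists_limit_pairFreq V T N hT
  have hcard : ∀ M, (0 : ℝ) < (T M).card := fun M => by exact_mod_cast (hT M).card_pos
  have hpos : 0 < e {(0, 1)} := by
    refine hδ.trans_le (ge_of_tendsto (htend 2 {(0, 1)} (by simp)) ?_)
    filter_upwards [eventually_indexLaw_bounds 2 0] with p hp
    obtain ⟨-, h1, h2⟩ := hp
    have := hN p.2 _ _ (h2 0 1 (by lia) (by lia)) (h1 1 (by lia)).2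
    rw [pairFreq, le_div_iff₀ (hcard _)]
    simpa using this
  have hev : ∀ᶠ p in (indexLaw m : Filter ((ℕ → ℕ) × ℕ)),
      ∀ S ∈ (Finset.range m ×ˢ Finset.range m).powerset, 0 < e S →
        1 / ((p.2 : ℝ) + 1) ≤ pairFreq (T p.2) (N p.2) p.1 S := by
    rw [eventually_all_finset]
    intro S hS
    rw [Finset.mem_powerset] at hS
    by_cases hpS : 0 < e S
    · obtain ⟨K, hK⟩ := exists_nat_one_div_lt (half_pos hpS)
      have h1 := (htend m S fun p hp => by simpa using hS hp).eventually
        (eventually_gt_nhds (half_lt_self hpS))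
      filter_upwards [h1, eventually_indexLaw_bounds m K] with p hp hp' _
      refine le_trans ?_ (hK.trans hp).le
      have : (K : ℝ) ≤ p.2 := by exact_mod_cast hp'.1.le
      gcongr
    · exact Eventually.of_forall fun p h => absurd h hpS
  obtain ⟨p, hp, -, hp1, hp2⟩ := (hev.and (eventually_indexLaw_bounds m 0)).exists
  obtain ⟨c, hc⟩ := hx p.2 p.1 hp2 fun i hi => (hp1 i hi).2
  have h := hp (bichromaticPairs m c)
    (Finset.mem_powerset.2 (Finset.filter_subset _ _)) (he.bichromaticPairs_pos hpos m c)
  rw [pairFreq, le_div_iff₀ (hcard _)] at h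
  refine absurd (h.trans (Nat.cast_le.2 (Finset.card_le_card fun b hb => ?_))) (not_le.2 hc)
  rw [Finset.mem_filter] at hb ⊢
  exact ⟨hb.1, fun i j hij hj hi hj' => hb.2 (i, j) (mem_bichromaticPairs.2 ⟨hij, hj, hi, hj'⟩)⟩

open Classical in
/-- Either a relation has a long clique, or it is sparse between all large subsets of some large
set. -/
theorem exists_clique_or_sparse {V : Type} (K : V → V → Prop) {ε γ : ℝ} (hε : 0 < ε)
    (hε1 : ε ≤ 1) (hγ : 0 < γ) (hγ1 : γ ≤ 1) (M : ℕ) : ∀ U : Finset V, U.Nonempty →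
    (∃ a : ℕ → V, (∀ i < M, a i ∈ U) ∧ ∀ i j, i < j → j < M → K (a i) (a j)) ∨
    ∃ U' ⊆ U, (ε * γ) ^ M * U.card ≤ (U'.card : ℝ) ∧ ∀ X ⊆ U', ∀ Y ⊆ U',
      γ * U'.card ≤ X.card → γ * U'.card ≤ Y.card →
        ∑ x ∈ X, ((Y.filter fun y => K x y).card : ℝ) ≤ ε * X.card * Y.card := by
  have hεγ : 0 < ε * γ := mul_pos hε hγ
  have hεγ1 : ε * γ ≤ 1 := mul_le_one₀ hε1 hγ.le hγ1
  induction M with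
  | zero => exact fun U hU => Or.inl ⟨fun _ => hU.choose, by simp, by simp⟩
  | succ M ih =>
    intro U hU
    by_cases hs : ∀ X ⊆ U, ∀ Y ⊆ U, γ * U.card ≤ X.card → γ * U.card ≤ Y.card →
        ∑ x ∈ X, ((Y.filter fun y => K x y).card : ℝ) ≤ ε * X.card * Y.card
    · exact Or.inr ⟨U, subset_rfl,
        mul_le_of_le_one_left (Nat.cast_nonneg _) (pow_le_one₀ hεγ.le hεγ1), hs⟩
    · push Not at hs
      obtain ⟨X, hX, Y, hY, -, hYc, hXY⟩ := hs
      obtain ⟨x, hx, hxY⟩ : ∃ x ∈ X, ε * Y.card < ((Y.filter fun y => K x y).card : ℝ) := by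
        by_contra! h
        have := Finset.sum_le_sum h
        simp only [Finset.sum_const, nsmul_eq_mul] at this
        linarith
      set U₁ := Y.filter fun y => K x y
      have hU₁ : U₁ ⊆ U := (Finset.filter_subset _ _).trans hY
      have hU₁n : U₁.Nonempty := Finset.card_pos.1 (by
        have : (0 : ℝ) < U₁.card := lt_of_le_of_lt (by positivity) hxY
        exact_mod_cast this)
      rcases ih U₁ hU₁n with ⟨a, ha, haK⟩ | ⟨U', hU', hc, hsp⟩
      · refine Or.inl ⟨fun i => if i = 0 then x else a (i - 1), fun i hi => ?_,
          fun i j hij hj => ?_⟩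
        · dsimp only
          split_ifs with h
          · exact hX hx
          · exact hU₁ (ha _ (by lia))
        · have hj0 : j ≠ 0 := by lia
          simp only [hj0, if_false]
          split_ifs with h
          · exact (Finset.mem_filter.1 (ha (j - 1) (by lia))).2
          · exact haK _ _ (by lia) (by lia)
      · refine Or.inr ⟨U', hU'.trans hU₁, le_trans ?_ hc, hsp⟩
        rw [pow_succ, mul_assoc]
        have : ε * γ * U.card ≤ U₁.card := by
          rw [mul_assoc]
          exact (mul_le_mul_of_nonneg_left hYc hε.le).trans hxY.le
        gcongr

open Classical in
/-- The number of triples in `X × Y × Z` related by `R`. -/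
noncomputable def tripleCount {V : Type} (R : V → V → V → Prop) (X Y Z : Finset V) : ℝ :=
  ∑ x ∈ X, ∑ y ∈ Y, ∑ b ∈ Z, if R x y b then 1 else 0

section tripleCount

variable {V : Type} {R : V → V → V → Prop}

theorem tripleCount_le (X Y Z : Finset V) :
    tripleCount R X Y Z ≤ X.card * Y.card * Z.card := by
  classical
  have : tripleCount R X Y Z ≤ ∑ x ∈ X, ∑ y ∈ Y, ∑ b ∈ Z, (1 : ℝ) :=
    Finset.sum_le_sum fun x _ => Finset.sum_le_sum fun y _ => Finset.sum_le_sum fun b _ => by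
      split_ifs <;> norm_num
  simpa [mul_assoc] using this

theorem tripleCount_swap_left (h : ∀ x y b, R x y b → R y x b) (X Y Z : Finset V) :
    tripleCount R X Y Z = tripleCount R Y X Z := by
  classical
  unfold tripleCount
  rw [Finset.sum_comm]
  exact Finset.sum_congr rfl fun y _ => Finset.sum_congr rfl fun x _ =>
    Finset.sum_congr rfl fun b _ => if_congr ⟨h _ _ _, h _ _ _⟩ rfl rfl

theorem tripleCount_swap_right (h : ∀ x y b, R x y b → R x b y) (X Y Z : Finset V) :
    tripleCount R X Y Z = tripleCount R X Z Y := by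
  classical
  unfold tripleCount
  refine Finset.sum_congr rfl fun x _ => ?_
  rw [Finset.sum_comm]
  exact Finset.sum_congr rfl fun b _ => Finset.sum_congr rfl fun y _ =>
    if_congr ⟨h _ _ _, h _ _ _⟩ rfl rfl

theorem tripleCount_union_left [DecidableEq V] {X X' : Finset V} (h : Disjoint X X')
    (Y Z : Finset V) :
    tripleCount R (X ∪ X') Y Z = tripleCount R X Y Z + tripleCount R X' Y Z := by
  unfold tripleCount
  rw [Finset.sum_union h]

theorem tripleCount_union [DecidableEq V] (h : ∀ x y b, R x y b → R y x b)
    (h' : ∀ x y b, R x y b → R x b y) {X T : Finset V} (hd : Disjoint X T) :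
    tripleCount R (X ∪ T) (X ∪ T) (X ∪ T) = tripleCount R X X X + 3 * tripleCount R X X T +
      3 * tripleCount R T T X + tripleCount R T T T := by
  have key : ∀ Y, tripleCount R (X ∪ T) (X ∪ T) Y =
      tripleCount R X X Y + 2 * tripleCount R X T Y + tripleCount R T T Y := by
    intro Y
    rw [tripleCount_union_left hd, tripleCount_swap_left h X, tripleCount_swap_left h T,
      tripleCount_union_left hd, tripleCount_union_left hd, tripleCount_swap_left h T X]
    ring
  have split : ∀ Y, tripleCount R Y Y (X ∪ T) = tripleCount R Y Y X + tripleCount R Y Y T := by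
    intro Y
    rw [tripleCount_swap_right h', tripleCount_swap_left h, tripleCount_union_left hd,
      tripleCount_swap_left h X, tripleCount_swap_left h T, tripleCount_swap_right h' Y X,
      tripleCount_swap_right h' Y T]
  have h1 : tripleCount R X T X = tripleCount R X X T := tripleCount_swap_right h' _ _ _
  have h2 : tripleCount R X T T = tripleCount R T T X := by
    rw [tripleCount_swap_left h, tripleCount_swap_right h']
  rw [split, key, key, h1, h2]
  ring

open Classical in
/-- A sparse codegree relation bounds the number of triples. -/
theorem tripleCount_le_of_sparse {X Y Z : Finset V} {ε δ : ℝ} (hδ : 0 ≤ δ)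
    (h : ∑ x ∈ X, ((Y.filter fun y =>
      δ * Z.card ≤ ((Z.filter fun b => R x y b).card : ℝ)).card : ℝ) ≤ ε * X.card * Y.card) :
    tripleCount R X Y Z ≤ (ε + δ) * (X.card * Y.card * Z.card) := by
  have hz : (0 : ℝ) ≤ Z.card := Nat.cast_nonneg _
  calc tripleCount R X Y Z
      ≤ ∑ x ∈ X, ∑ y ∈ Y, ((if δ * Z.card ≤ ((Z.filter fun b => R x y b).card : ℝ) then 1 else 0)
          * (Z.card : ℝ) + δ * Z.card) := by
        refine Finset.sum_le_sum fun x _ => Finset.sum_le_sum fun y _ => ?_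
        rw [Finset.sum_boole]
        split_ifs with hK
        · have : ((Z.filter fun b => R x y b).card : ℝ) ≤ Z.card :=
            Nat.cast_le.2 (Finset.card_filter_le _ _)
          nlinarith
        · linarith
    _ = (∑ x ∈ X, ((Y.filter fun y =>
          δ * Z.card ≤ ((Z.filter fun b => R x y b).card : ℝ)).card : ℝ)) * Z.card +
          δ * (X.card * Y.card * Z.card) := by
        simp only [Finset.sum_add_distrib, ← Finset.sum_mul, Finset.sum_boole, Finset.sum_const,
          nsmul_eq_mul]
        ring
    _ ≤ ε * X.card * Y.card * Z.card + δ * (X.card * Y.card * Z.card) := by gcongr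
    _ = _ := by ring

end tripleCount

/-- Some subset of prescribed size has at most average weight. -/
theorem exists_subset_card_eq_sum_le {V : Type} (g : V → ℝ) {N : ℕ} (T : Finset V)
    (hN : N ≤ T.card) :
    ∃ t ⊆ T, t.card = N ∧ T.card * ∑ b ∈ t, g b ≤ N * ∑ b ∈ T, g b := by
  classical
  induction h : T.card - N generalizing T with
  | zero =>
    have : T.card = N := by lia
    exact ⟨T, subset_rfl, this, by rw [this]⟩
  | succ r ih =>
    obtain ⟨v, hv, hmax⟩ := Finset.exists_max_image T g (Finset.card_pos.1 (by lia))
    have hc : (T.erase v).card = T.card - 1 := Finset.card_erase_of_mem hv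
    obtain ⟨t, ht, htc, hsum⟩ := ih (T.erase v) (by lia) (by lia)
    refine ⟨t, ht.trans (Finset.erase_subset _ _), htc, ?_⟩
    have h1 : ∑ b ∈ T, g b = g v + ∑ b ∈ T.erase v, g b := (Finset.add_sum_erase T g hv).symm
    have h2 : ∑ b ∈ t, g b ≤ N * g v := by
      have := Finset.sum_le_sum fun b hb => hmax b (Finset.mem_of_mem_erase (ht hb))
      simpa [htc] using this
    have h3 : (T.card : ℝ) = (T.erase v).card + 1 := by
      rw [hc]
      have : 1 ≤ T.card := by lia
      push_cast [this]
      ring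
    rw [h1, h3]
    linarith

open Classical in
/-- Either there is a set `T` with a long sequence of vertices pairwise of positive density into
`T`, or some set of size `(s + 1) * N` spans few triples. -/
theorem exists_clique_or_few_triples {ε δ : ℝ} (hε : 0 < ε) (hε1 : ε ≤ 1) (hδ : 0 < δ) (M s : ℕ) :
    ∃ κ : ℝ, 0 < κ ∧ κ ≤ 1 ∧ ∀ {V : Type} (R : V → V → V → Prop)
      (_ : ∀ x y b, R x y b → R y x b) (_ : ∀ x y b, R x y b → R x b y) (U : Finset V),
      1 ≤ κ * U.card →
      (∃ (T : Finset V) (a : ℕ → V), κ * U.card ≤ (T.card : ℝ) ∧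
        ∀ i j, i < j → j < M → δ * T.card ≤ ((T.filter fun b => R (a i) (a j) b).card : ℝ)) ∨
      ∃ N : ℕ, ∃ X ⊆ U, N ≤ U.card ∧ κ * U.card ≤ N ∧ X.card = (s + 1) * N ∧
        tripleCount R X X X ≤ ((ε + δ) * (s + 1) ^ 3 + 2 * (s + 1) ^ 2) * N ^ 3 := by
  induction s with
  | zero =>
    refine ⟨1, one_pos, le_rfl, fun R _ _ U _ => Or.inr ⟨U.card, U, subset_rfl, le_rfl,
      by simp, by simp, (tripleCount_le U U U).trans ?_⟩⟩
    have : (0 : ℝ) ≤ (U.card : ℝ) ^ 3 := by positivity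
    simp only [Nat.cast_zero, zero_add]
    nlinarith
  | succ s ih =>
    obtain ⟨κ, hκ, hκ1, ih⟩ := ih
    have hεκ : 0 < ε * κ := mul_pos hε hκ
    have hp1 : (ε * κ) ^ M ≤ 1 := pow_le_one₀ hεκ.le (mul_le_one₀ hε1 hκ.le hκ1)
    have hp0 : 0 < (ε * κ) ^ M := pow_pos hεκ M
    have hκ4 : κ * (ε * κ) ^ M / 4 ≤ 1 / 4 := by
      have := mul_le_one₀ hκ1 hp0.le hp1
      linarith
    refine ⟨κ * (ε * κ) ^ M / 4, by positivity, by linarith, fun {V} R h12 h23 U hU => ?_⟩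
    have hUc : (4 : ℝ) ≤ U.card := by
      have : κ * (ε * κ) ^ M / 4 * U.card ≤ 1 / 4 * U.card := by gcongr
      linarith
    have hUc' : 4 ≤ U.card := by exact_mod_cast hUc
    obtain ⟨W, hWU, hWc⟩ := Finset.exists_subset_card_eq (Nat.div_le_self U.card 2)
    set T := U \ W with hT
    have hTc : T.card = U.card - U.card / 2 := by rw [hT, Finset.card_sdiff_of_subset hWU, hWc]
    have hW4 : (U.card : ℝ) ≤ 4 * W.card := by
      have : U.card ≤ 4 * W.card := by lia
      exact_mod_cast this
    have hT4 : (U.card : ℝ) ≤ 4 * T.card := by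
      have : U.card ≤ 4 * T.card := by lia
      exact_mod_cast this
    have hκU : κ * (ε * κ) ^ M / 4 * U.card ≤ κ * ((ε * κ) ^ M * W.card) := by
      have : κ * (ε * κ) ^ M / 4 * U.card ≤ κ * (ε * κ) ^ M / 4 * (4 * W.card) := by gcongr
      linarith
    rcases exists_clique_or_sparse
      (fun x y => δ * T.card ≤ ((T.filter fun b => R x y b).card : ℝ)) hε hε1 hκ hκ1 M W
      (Finset.card_pos.1 (by lia)) with ⟨a, -, ha⟩ | ⟨W', hW', hW'c, hsp⟩
    · refine Or.inl ⟨T, a, ?_, ha⟩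
      have : κ * (ε * κ) ^ M / 4 * U.card ≤ 1 / 4 * U.card := by gcongr
      linarith
    · have hκW' : κ * (ε * κ) ^ M / 4 * U.card ≤ κ * W'.card :=
        hκU.trans (mul_le_mul_of_nonneg_left hW'c hκ.le)
      rcases ih R h12 h23 W' (hU.trans hκW') with ⟨T', a, hT', ha⟩ |
        ⟨N, X, hX, hNW, hκN, hXc, hXt⟩
      · exact Or.inl ⟨T', a, hκW'.trans hT', ha⟩
      · have hNT : N ≤ T.card := by
          have := Finset.card_le_card hW'
          lia
        obtain ⟨t, ht, htc, htsum⟩ := exists_subset_card_eq_sum_le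
          (fun b => ∑ x ∈ X, ∑ y ∈ X, if R x y b then (1 : ℝ) else 0) T hNT
        have hXW : X ⊆ W := hX.trans hW'
        have hd : Disjoint X t :=
          (Finset.disjoint_sdiff (s := W) (t := U)).mono hXW ht
        have hsumT : ∀ Z : Finset V, ∑ b ∈ Z, ∑ x ∈ X, ∑ y ∈ X, (if R x y b then (1 : ℝ) else 0) =
            tripleCount R X X Z := by
          intro Z
          rw [Finset.sum_comm, tripleCount]
          exact Finset.sum_congr rfl fun x _ => Finset.sum_comm
        rw [hsumT, hsumT] at htsum
        have hXκ : κ * W'.card ≤ X.card := by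
          refine hκN.trans ?_
          rw [hXc]
          exact_mod_cast Nat.le_mul_of_pos_left N (Nat.succ_pos s)
        have h1 := tripleCount_le_of_sparse (R := R) hδ.le (hsp X hX X hX hXκ hXκ)
        have hTpos : (0 : ℝ) < T.card := by linarith
        have hXc' : (X.card : ℝ) = (s + 1) * N := by rw [hXc]; push_cast; ring
        have h2 : tripleCount R X X t ≤ (ε + δ) * (s + 1) ^ 2 * N ^ 3 := by
          refine le_of_mul_le_mul_left (htsum.trans ?_) hTpos
          refine (mul_le_mul_of_nonneg_left h1 (Nat.cast_nonneg N)).trans (le_of_eq ?_)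
          rw [hXc']
          ring
        have h3 := tripleCount_le (R := R) t t X
        have h4 := tripleCount_le (R := R) t t t
        rw [hXc', htc] at h3
        rw [htc] at h4
        refine Or.inr ⟨N, X ∪ t, ?_, ?_, hκW'.trans hκN, ?_, ?_⟩
        · exact Finset.union_subset (hXW.trans hWU) (ht.trans Finset.sdiff_subset)
        · exact hNT.trans (Finset.card_le_card Finset.sdiff_subset)
        · rw [Finset.card_union_of_disjoint hd, hXc, htc]
          ring
        · rw [tripleCount_union h12 h23 hd]
          push_cast
          have hN3 : (0 : ℝ) ≤ (N : ℝ) ^ 3 := by positivity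
          have hs : (0 : ℝ) ≤ s := Nat.cast_nonneg s
          have h5 : 0 ≤ (ε + δ) * (3 * s + 4) * (N : ℝ) ^ 3 := by positivity
          have h6 : 0 ≤ (s + 2) * (N : ℝ) ^ 3 := by positivity
          linarith

theorem cast_choose_three (q : ℕ) : (q.choose 3 : ℝ) = q * (q - 1) * (q - 2) / 6 := by
  induction q with
  | zero => simp
  | succ q ih =>
    rw [Nat.choose_succ_succ' q 2]
    push_cast
    rw [ih, Nat.cast_choose_two]
    ring

theorem card_edges_le_tripleCount {V : Type} [DecidableEq V] (H : H3 V) (X : Finset V) :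
    ((H.edges.filter fun e => e ⊆ X).card : ℝ) ≤
      tripleCount (fun x y b => {x, y, b} ∈ H.edges) X X X := by
  classical
  have hsub : (H.edges.filter fun e => e ⊆ X) ⊆ ((X ×ˢ X ×ˢ X).filter fun p : V × V × V =>
      {p.1, p.2.1, p.2.2} ∈ H.edges).image fun p => {p.1, p.2.1, p.2.2} := by
    intro e he
    obtain ⟨he, heX⟩ := Finset.mem_filter.1 he
    obtain ⟨x, y, z, -, -, -, rfl⟩ := Finset.card_eq_three.1 (H.card3 e he)
    refine Finset.mem_image.2 ⟨(x, y, z), Finset.mem_filter.2 ⟨?_, he⟩, rfl⟩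
    simp only [Finset.mem_product]
    exact ⟨heX (by simp), heX (by simp), heX (by simp)⟩
  refine (Nat.cast_le.2 ((Finset.card_le_card hsub).trans Finset.card_image_le)).trans
    (le_of_eq ?_)
  rw [← Finset.sum_boole, Finset.sum_product]
  simp only [Finset.sum_product, tripleCount]
  congr!

/-- Uniformly dense hypergraphs contain `m` vertices such that every two-colouring of them is
realized by many vertices `b`: all pairs coloured `false, true` in this order form an edge
with `b`. -/
theorem exists_colouring_rich_of_uniformlyDense {d : ℝ} (hd : 0 < d) (hd1 : d ≤ 1) (m K : ℕ) :
    ∃ η : ℝ, 0 < η ∧ ∃ n₀ : ℕ, ∀ n, n₀ ≤ n → ∀ H : H3 (Fin n), H.uniformlyDense d η →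
      ∃ a : ℕ → Fin n, (∀ i j, i < j → j < m → a i ≠ a j) ∧ ∀ c : ℕ → Bool, ∃ B : Finset (Fin n),
        K ≤ B.card ∧ ∀ b ∈ B, ∀ i j, i < j → j < m → c i = false → c j = true →
          {a i, a j, b} ∈ H.edges := by
  classical
  have hε : 0 < d / 24 := by positivity
  obtain ⟨M, τ, hτ, hM⟩ := exists_subseq_realizing_colourings (d / 24) hε m
  obtain ⟨s, hs⟩ := exists_nat_gt (42 / d)
  obtain ⟨κ, hκ, hκ1, hU⟩ := exists_clique_or_few_triples hε (by linarith) hε M s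
  obtain ⟨n₁, hn₁⟩ := exists_nat_gt (1 / κ)
  obtain ⟨n₂, hn₂⟩ := exists_nat_gt (K / (τ * κ))
  refine ⟨κ ^ 3, by positivity, max n₁ n₂, fun n hn H hH => ?_⟩
  have hn1 : 1 ≤ κ * n := by
    have : (n₁ : ℝ) ≤ n := by exact_mod_cast (le_max_left _ _).trans hn
    rw [div_lt_iff₀ hκ] at hn₁
    nlinarith
  have hn2 : (K : ℝ) ≤ τ * (κ * n) := by
    have h : (n₂ : ℝ) ≤ n := by exact_mod_cast (le_max_right _ _).trans hn
    have hp : 0 < τ * κ := by positivity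
    rw [div_lt_iff₀ hp] at hn₂
    nlinarith
  rcases hU (fun x y b : Fin n => {x, y, b} ∈ H.edges)
    (fun x y b h => by rwa [Finset.insert_comm]) (fun x y b h => by rwa [Finset.pair_comm])
    Finset.univ (by simpa using hn1) with ⟨T, a, hT, ha⟩ | ⟨N, X, -, -, hN, hXc, hX⟩
  · rw [Finset.card_univ, Fintype.card_fin] at hT
    have hTpos : (0 : ℝ) < T.card := by linarith
    obtain ⟨x, hx, hxM, hxc⟩ := hM T (fun i j b => {a i, a j, b} ∈ H.edges)
      (Finset.card_pos.1 (by exact_mod_cast hTpos)) ha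
    refine ⟨fun i => a (x i), fun i j hij hj heq => ?_, fun c => ?_⟩
    · have h1 := ha _ _ (hx i j hij hj) (hxM j hj)
      have h2 : (0 : ℝ) < d / 24 * T.card := by positivity
      have h3 := h2.trans_le h1
      rw [Nat.cast_pos, Finset.card_pos] at h3
      obtain ⟨b, hb⟩ := h3
      have h4 := H.card3 _ ((@Finset.mem_filter _ _ (_) _ _).1 hb).2
      dsimp only at heq
      rw [heq, Finset.insert_eq_of_mem (Finset.mem_insert_self _ _)] at h4
      have := Finset.card_le_two (a := a (x j)) (b := b)
      lia
    · have h1 : τ * (κ * n) ≤ τ * T.card := by gcongr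
      exact ⟨_, Nat.cast_le.1 (hn2.trans (h1.trans (hxc c))),
        fun b hb => ((@Finset.mem_filter _ _ (_) _ _).1 hb).2⟩
  · exfalso
    rw [Finset.card_univ, Fintype.card_fin] at hN
    have h1 := (hH X).trans ((card_edges_le_tripleCount H X).trans hX)
    rw [hXc, cast_choose_three, Fintype.card_fin] at h1
    push_cast at h1
    set S : ℝ := (s : ℝ) + 1 with hS
    have hN1 : (1 : ℝ) ≤ N := hn1.trans hN
    have hdS : 42 < d * S := by
      rw [div_lt_iff₀ hd] at hs
      nlinarith
    have hS1 : 1 ≤ S := by have : (0 : ℝ) ≤ s := Nat.cast_nonneg s; linarith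
    have h2 : κ ^ 3 * n ^ 3 ≤ (N : ℝ) ^ 3 := by
      rw [← mul_pow]
      gcongr
    have hN3 : 0 < (N : ℝ) ^ 3 := by positivity
    have h3 : (N : ℝ) ^ 2 ≤ N ^ 3 := pow_le_pow_right₀ hN1 (by norm_num)
    have h4 : d * S ^ 2 * N ^ 2 ≤ S ^ 2 * N ^ 3 := by
      have : d * S ^ 2 ≤ S ^ 2 := by nlinarith [sq_nonneg S]
      gcongr
    have h5 : (N : ℝ) ^ 3 ≤ S ^ 2 * N ^ 3 :=
      le_mul_of_one_le_left hN3.le (one_le_pow₀ hS1)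
    have h6 : 42 * (S ^ 2 * (N : ℝ) ^ 3) < d * S * (S ^ 2 * N ^ 3) :=
      mul_lt_mul_of_pos_right hdS (by positivity)
    have h7 : 0 ≤ d * (S * N) := by positivity
    linarith

/-- A hypergraph has uniform Turán density zero if its edges are of the form `{a, a', b}` with
`a < a'` in an ordered set `S` and `b ∉ S`, where `a`, `a'` have colours `false`, `true` in a
colouring depending on `b`. -/
theorem uniformTuranDensity_nonpos {W α : Type} [DecidableEq W] [Fintype W] [LinearOrder α]
    (F : H3 W) (S : Finset W) (key : W → α) (hkey : Set.InjOn key S) (c : W → W → Bool)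
    (hF : ∀ e ∈ F.edges, ∃ a ∈ S, ∃ a' ∈ S, ∃ b ∉ S, e = {a, a', b} ∧ key a < key a' ∧
      c b a = false ∧ c b a' = true) :
    uniformTuranDensity F ≤ 0 := by
  classical
  refine Real.sSup_nonpos fun d hd => ?_
  obtain ⟨-, hd1, hd⟩ := hd
  by_contra! hd0
  obtain ⟨η, hη, n₀, hn₀⟩ :=
    exists_colouring_rich_of_uniformlyDense hd0 hd1 (Fintype.card W) (2 * Fintype.card W)
  obtain ⟨n, hn, H, hfree, hdense⟩ := hd η hη n₀
  obtain ⟨x, hx, hxc⟩ := hn₀ n hn H hdense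
  let r : W → ℕ := fun w => (S.filter fun v => key v < key w).card
  have hr : ∀ w ∈ S, r w < Fintype.card W := by
    intro w hw
    refine lt_of_lt_of_le (Finset.card_lt_card ?_) (Finset.card_le_univ S)
    exact Finset.filter_ssubset.2 ⟨w, hw, lt_irrefl _⟩
  have hrlt : ∀ v ∈ S, ∀ w, key v < key w → r v < r w := by
    intro v hv w hvw
    refine Finset.card_lt_card (Finset.ssubset_iff_of_subset ?_ |>.2 ⟨v, ?_, ?_⟩)
    · exact Finset.monotone_filter_right _ fun u _ hu => hu.trans hvw
    · simp [hv, hvw]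
    · simp
  have hrinj : ∀ v ∈ S, ∀ w ∈ S, r v = r w → v = w := by
    intro v hv w hw h
    rcases lt_trichotomy (key v) (key w) with h' | h' | h'
    · exact absurd h (hrlt v hv w h').ne
    · exact hkey hv hw h'
    · exact absurd h (hrlt w hw v h').ne'
  have hxinj : ∀ v ∈ S, ∀ w ∈ S, x (r v) = x (r w) → v = w := by
    intro v hv w hw h
    refine hrinj v hv w hw ?_
    rcases lt_trichotomy (r v) (r w) with h' | h' | h'
    · exact absurd h (hx _ _ h' (hr w hw))
    · exact h'
    · exact absurd h.symm (hx _ _ h' (hr v hv))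
  choose B hBc hB using fun b : W => hxc fun i => decide (∃ w ∈ S, r w = i ∧ c b w = true)
  have hcol : ∀ b, ∀ w ∈ S, decide (∃ v ∈ S, r v = r w ∧ c b v = true) = c b w := by
    intro b w hw
    rw [Bool.eq_iff_iff, decide_eq_true_iff]
    exact ⟨fun ⟨v, hv, hvw, h⟩ => hrinj v hv w hw hvw ▸ h, fun h => ⟨w, hw, rfl, h⟩⟩
  let A : Finset (Fin n) := (Finset.range (Fintype.card W)).image x
  have hA : A.card ≤ Fintype.card W := by
    simpa using Finset.card_image_le (s := Finset.range (Fintype.card W)) (f := x)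
  obtain ⟨f, hfinj, hf⟩ : ∃ f : W → Fin n, Function.Injective f ∧ ∀ b, f b ∈ B b \ A := by
    refine (Finset.all_card_le_biUnion_card_iff_exists_injective _).1 fun s => ?_
    rcases s.eq_empty_or_nonempty with rfl | ⟨b, hb⟩
    · simp
    · refine le_trans ?_ (Finset.card_le_card
        (Finset.subset_biUnion_of_mem (fun b => B b \ A) hb))
      have h1 := Finset.card_le_univ s
      have h2 := hBc b
      have h3 := Finset.le_card_sdiff A (B b)
      lia
  have hfA : ∀ b, ∀ w ∈ S, f b ≠ x (r w) := fun b w hw h =>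
    (Finset.mem_sdiff.1 (hf b)).2
      (Finset.mem_image.2 ⟨r w, Finset.mem_range.2 (hr w hw), h.symm⟩)
  refine hfree ⟨fun w => if w ∈ S then x (r w) else f w, fun v w h => ?_, fun e he => ?_⟩
  · dsimp only at h
    split_ifs at h with hv hw hw
    · exact hxinj v hv w hw h
    · exact absurd h.symm (hfA w v hv)
    · exact absurd h (hfA v w hw)
    · exact hfinj h
  · obtain ⟨a, ha, a', ha', b, hb, rfl, haa', hca, hca'⟩ := hF e he
    have := hB b (f b) (Finset.mem_sdiff.1 (hf b)).1 (r a) (r a') (hrlt a ha a' haa') (hr a' ha')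
      ((hcol b a ha).trans hca) ((hcol b a' ha').trans hca')
    simpa [Finset.image_insert, ha, ha', hb] using this

section TwoOne

variable {A B V : Type} [Fintype A] [Fintype B] [DecidableEq V]

open Classical in
/-- The 3-graph on the disjoint union of `A` and `B` whose edges are the `{a, a', b}` with
`R a a' b`. -/
noncomputable def twoOneGraph (φ : A ⊕ B ≃ V) (R : A → A → B → Prop)
    (hR : ∀ a a' b, R a a' b → a ≠ a') : H3 V where
  edges := (Finset.univ.filter fun p : A × A × B => R p.1 p.2.1 p.2.2).image
    fun p => {φ (.inl p.1), φ (.inl p.2.1), φ (.inr p.2.2)}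
  card3 e he := by
    obtain ⟨p, hp, rfl⟩ := Finset.mem_image.1 he
    have := hR _ _ _ ((@Finset.mem_filter _ _ (_) _ _).1 hp).2
    exact Finset.card_eq_three.2 ⟨_, _, _, by simpa using this, by simp, by simp, rfl⟩

variable {φ : A ⊕ B ≃ V} {R : A → A → B → Prop} {hR : ∀ a a' b, R a a' b → a ≠ a'}

theorem mem_twoOneGraph {e : Finset V} : e ∈ (twoOneGraph φ R hR).edges ↔
    ∃ a a' b, R a a' b ∧ e = {φ (.inl a), φ (.inl a'), φ (.inr b)} := by
  simp only [twoOneGraph, Finset.mem_image, Finset.mem_filter, Finset.mem_univ, true_and,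
    Prod.exists, eq_comm]

theorem mem_twoOneGraph_of_or {a a' : A} {b : B} (h : R a a' b ∨ R a' a b) :
    {φ (.inl a), φ (.inl a'), φ (.inr b)} ∈ (twoOneGraph φ R hR).edges := by
  rcases h with h | h
  · exact mem_twoOneGraph.2 ⟨_, _, _, h, rfl⟩
  · exact mem_twoOneGraph.2 ⟨_, _, _, h, Finset.insert_comm _ _ _⟩

theorem card_le_codeg_inl_inl {a a' : A} {D : Finset B}
    (hD : ∀ b ∈ D, R a a' b ∨ R a' a b) :
    D.card ≤ (twoOneGraph φ R hR).codeg (φ (.inl a)) (φ (.inl a')) := by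
  refine Finset.card_le_card_of_injOn (fun b => {φ (.inl a), φ (.inl a'), φ (.inr b)})
    (fun b hb => ?_) fun b _ b' _ h => ?_
  · exact Finset.mem_filter.2 ⟨mem_twoOneGraph_of_or (hD b hb), by simp, by simp⟩
  · have : φ (.inr b) ∈ ({φ (.inl a), φ (.inl a'), φ (.inr b')} : Finset V) := by
      dsimp only at h
      rw [← h]
      simp
    simpa using this

theorem card_le_codeg_inl_inr {a : A} {b : B} {D : Finset A}
    (hD : ∀ a' ∈ D, R a a' b ∨ R a' a b) :
    D.card ≤ (twoOneGraph φ R hR).codeg (φ (.inl a)) (φ (.inr b)) := by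
  refine Finset.card_le_card_of_injOn (fun a' => {φ (.inl a), φ (.inl a'), φ (.inr b)})
    (fun a' ha' => ?_) fun a' ha' a'' _ h => ?_
  · exact Finset.mem_filter.2 ⟨mem_twoOneGraph_of_or (hD a' ha'), by simp, by simp⟩
  · have : φ (.inl a') ∈ ({φ (.inl a), φ (.inl a''), φ (.inr b)} : Finset V) := by
      dsimp only at h
      rw [← h]
      simp
    have hne : a' ≠ a := by
      rcases hD a' ha' with h | h
      · exact (hR _ _ _ h).symm
      · exact hR _ _ _ h
    simpa [hne] using this

theorem twoOneGraph_free {α : Type} [LinearOrder α] [Inhabited α] {k : ℕ}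
    (h : ∀ D : Finset B, D.card ≤ k → ∃ key : A → α, Function.Injective key ∧
      ∃ c : B → A → Bool, ∀ b ∈ D, ∀ a a', R a a' b →
        (key a < key a' ∧ c b a = false ∧ c b a' = true) ∨
        (key a' < key a ∧ c b a' = false ∧ c b a = true))
    (W : Type) [DecidableEq W] [Fintype W] (hW : Fintype.card W ≤ k) (F : H3 W)
    (hF : 0 < uniformTuranDensity F) : (twoOneGraph φ R hR).free F := by
  classical
  rintro ⟨f, hf, hfe⟩
  refine absurd hF (not_lt.2 ?_)
  let g : W → A ⊕ B := fun w => φ.symm (f w)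
  have hg : Function.Injective g := φ.symm.injective.comp hf
  have hgf : ∀ w x, f w = φ x → g w = x := fun w x h => by simp [g, h]
  obtain ⟨key, hkey, c, hc⟩ := h
    (Finset.univ.filter fun b => ∃ w, g w = .inr b) (by
      refine le_trans ?_ hW
      refine (Finset.card_le_card_of_injOn Sum.inr (t := Finset.univ.image g) (fun b hb => ?_)
        (Sum.inr_injective.injOn)).trans Finset.card_image_le
      simpa using hb)
  refine uniformTuranDensity_nonpos F (Finset.univ.filter fun w => (g w).isLeft)
    (fun w => Sum.elim key (fun _ => default) (g w)) ?_
    (fun w v => Sum.elim (fun _ => false) (fun b => Sum.elim (c b) (fun _ => false) (g v)) (g w))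
    fun e he => ?_
  · intro v hv w hw hvw
    simp only [Finset.coe_filter, Finset.mem_univ, true_and, Set.mem_ofPred_eq,
      Sum.isLeft_iff] at hv hw
    obtain ⟨a, ha⟩ := hv
    obtain ⟨a', ha'⟩ := hw
    simp only [ha, ha', Sum.elim_inl] at hvw
    exact hg (by rw [ha, ha', hkey hvw])
  · obtain ⟨a, a', b, hab, heq⟩ := mem_twoOneGraph.1 (hfe e he)
    have hex : ∀ x ∈ ({φ (.inl a), φ (.inl a'), φ (.inr b)} : Finset V), ∃ w, f w = x := by
      intro x hx
      rw [← heq] at hx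
      obtain ⟨w, -, hw⟩ := Finset.mem_image.1 hx
      exact ⟨w, hw⟩
    obtain ⟨w₁, h₁⟩ := hex (φ (.inl a)) (by simp)
    obtain ⟨w₂, h₂⟩ := hex (φ (.inl a')) (by simp)
    obtain ⟨w₃, h₃⟩ := hex (φ (.inr b)) (by simp)
    have hew : e = {w₁, w₂, w₃} := by
      refine Finset.image_injective hf ?_
      rw [heq, Finset.image_insert, Finset.image_insert, Finset.image_singleton, h₁, h₂, h₃]
    have g₁ := hgf _ _ h₁
    have g₂ := hgf _ _ h₂
    have g₃ := hgf _ _ h₃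
    rcases hc b (by simpa using ⟨w₃, g₃⟩) a a' hab with hlt | hlt
    · exact ⟨w₁, by simp [g₁], w₂, by simp [g₂], w₃, by simp [g₃], hew, by simpa [g₁, g₂, g₃]⟩
    · exact ⟨w₂, by simp [g₂], w₁, by simp [g₁], w₃, by simp [g₃],
        hew.trans (Finset.insert_comm _ _ _), by simpa [g₁, g₂, g₃]⟩

end TwoOne

theorem ZMod.two_eq_zero_or_one (x : ZMod 2) : x = 0 ∨ x = 1 := by
  revert x
  decide

theorem ZMod.val_sub_one_lt {m : ℕ} [Fact (1 < m)] {x : ZMod m} (hx : x ≠ 0) :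
    (x - 1).val < x.val := by
  have : NeZero m := ⟨by have := Fact.out (p := 1 < m); omega⟩
  have hpos : 0 < x.val := Nat.pos_of_ne_zero (by simpa using hx)
  rw [ZMod.val_sub (by rw [ZMod.val_one]; exact hpos), ZMod.val_one]
  omega

section DotProduct

variable {ι : Type} [Fintype ι]

theorem exists_dotProduct_eq_zero_one [DecidableEq ι] {u v : ι → ZMod 2} (hv : v ≠ 0)
    (huv : u ≠ v) : ∃ z, dotProduct u z = 0 ∧ dotProduct v z = 1 := by
  obtain ⟨p, hp⟩ := Function.ne_iff.1 huv
  have hne : ∀ x : ZMod 2, x ≠ 0 → x = 1 := by decide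
  rcases ZMod.two_eq_zero_or_one (v p) with h0 | h1
  · have hup : u p = 1 := hne _ (h0 ▸ hp)
    obtain ⟨q, hq⟩ := Function.ne_iff.1 hv
    have hvq : v q = 1 := hne _ hq
    rcases ZMod.two_eq_zero_or_one (u q) with hq0 | hq1
    · exact ⟨Pi.single q 1, by simp [hq0], by simp [hvq]⟩
    · exact ⟨Pi.single q 1 + Pi.single p 1, by simp [dotProduct_add, hq1, hup]; decide,
        by simp [dotProduct_add, hvq, h0]⟩
  · have hup : u p = 0 := by
      rcases ZMod.two_eq_zero_or_one (u p) with h | h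
      · exact h
      · exact absurd (h.trans h1.symm) hp
    exact ⟨Pi.single p 1, by simp [hup], by simp [h1]⟩

theorem two_pow_card_le_four_mul_card_dotProduct [DecidableEq ι] {u v : ι → ZMod 2} (hv : v ≠ 0)
    (huv : u ≠ v) : 2 ^ Fintype.card ι ≤
      4 * (Finset.univ.filter fun y => dotProduct u y = 0 ∧ dotProduct v y = 1).card := by
  set D := Finset.univ.filter fun y : ι → ZMod 2 => dotProduct u y = 0 ∧ dotProduct v y = 1
  have hD : ∀ y, y ∈ D ↔ dotProduct u y = 0 ∧ dotProduct v y = 1 := by simp [D]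
  obtain ⟨z₁, h₁u, h₁v⟩ := exists_dotProduct_eq_zero_one hv huv
  obtain ⟨z₂, h₂⟩ : ∃ z₂, u ≠ 0 → dotProduct u z₂ = 1 := by
    by_cases hu : u = 0
    · exact ⟨0, fun h => absurd hu h⟩
    · obtain ⟨z, -, hz⟩ := exists_dotProduct_eq_zero_one hu huv.symm
      exact ⟨z, fun _ => hz⟩
  let Z : Finset (ι → ZMod 2) := {0, z₁, z₂, z₁ + z₂}
  have hZ : Z.card ≤ 4 := Finset.card_le_four
  have hone : (1 : ZMod 2) + 1 = 0 := by decide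
  have hflip : ∀ y, dotProduct u y = 0 → ∃ z ∈ ({0, z₁} : Finset (ι → ZMod 2)), y + z ∈ D := by
    intro y hy
    rcases ZMod.two_eq_zero_or_one (dotProduct v y) with h | h
    · exact ⟨z₁, by simp, by simp [hD, dotProduct_add, hy, h, h₁u, h₁v]⟩
    · exact ⟨0, by simp, by simp [hD, hy, h]⟩
  have hcov : ∀ y, ∃ z ∈ Z, y + z ∈ D := by
    intro y
    rcases ZMod.two_eq_zero_or_one (dotProduct u y) with h | h
    · obtain ⟨z, hz, hyz⟩ := hflip y h
      refine ⟨z, ?_, hyz⟩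
      simp only [Finset.mem_insert, Finset.mem_singleton] at hz
      rcases hz with rfl | rfl <;> simp [Z]
    · have hu : u ≠ 0 := by
        rintro rfl
        simp at h
      obtain ⟨z, hz, hyz⟩ := hflip (y + z₂) (by rw [dotProduct_add, h, h₂ hu, hone])
      refine ⟨z + z₂, ?_, by rwa [add_comm z, ← add_assoc]⟩
      simp only [Finset.mem_insert, Finset.mem_singleton] at hz
      rcases hz with rfl | rfl <;> simp [Z]
  have hcard : (Finset.univ : Finset (ι → ZMod 2)).card ≤ (Z ×ˢ D).card := by
    refine (Finset.card_le_card fun y _ => ?_).trans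
      (Finset.card_image_le (f := fun p : (ι → ZMod 2) × (ι → ZMod 2) => p.2 - p.1))
    obtain ⟨z, hz, hyz⟩ := hcov y
    exact Finset.mem_image.2 ⟨(z, y + z), Finset.mem_product.2 ⟨hz, hyz⟩, by simp⟩
  rw [Finset.card_product, Finset.card_univ, Fintype.card_fun, ZMod.card] at hcard
  exact hcard.trans (Nat.mul_le_mul_right _ hZ)

end DotProduct

section Construction

variable {m : ℕ} {ι : Type} [Fintype ι]

/-- The triples `(s, u), (t, v), (r, y)` spanning an edge of the construction: over the cyclic
group, `s` and `t` are symmetric about `r` or close to it, and in the latter case the scalar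
products with `y` are prescribed. -/
def cyclicRel (τ : (ι → ZMod 2) → ℕ) (a a' b : ZMod m × (ι → ZMod 2)) : Prop :=
  (a.1 ≠ a'.1 ∧ a.1 + a'.1 = 2 * b.1) ∨
  (a.1 = b.1 ∧ a'.1 = b.1 ∧ τ a.2 < τ a'.2 ∧ dotProduct a.2 b.2 = 0 ∧ dotProduct a'.2 b.2 = 1) ∨
  (a.1 = b.1 - 1 ∧ a'.1 = b.1 ∧ dotProduct a'.2 b.2 = 1) ∨
  (a.1 = b.1 ∧ a'.1 = b.1 + 1 ∧ dotProduct a.2 b.2 = 0)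

variable {τ : (ι → ZMod 2) → ℕ}

theorem cyclicRel.ne [Fact (1 < m)] {a a' b : ZMod m × (ι → ZMod 2)} (h : cyclicRel τ a a' b) :
    a ≠ a' := by
  rintro rfl
  rcases h with ⟨h, -⟩ | ⟨-, -, h, -⟩ | ⟨h, h', -⟩ | ⟨h, h', -⟩
  · exact h rfl
  · exact lt_irrefl _ h
  · rw [h'] at h
    exact one_ne_zero (sub_eq_self.1 h.symm)
  · rw [h] at h'
    simp at h'

theorem cyclicRel.exists_key_colouring {k : ℕ} (hk : 0 < k) (hτ : Function.Injective τ)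
    (D : Finset (ZMod (2 * k + 1) × (ι → ZMod 2))) (hD : D.card ≤ k) :
    ∃ key : ZMod (2 * k + 1) × (ι → ZMod 2) → ℕ ×ₗ ℕ, Function.Injective key ∧
      ∃ c : ZMod (2 * k + 1) × (ι → ZMod 2) → ZMod (2 * k + 1) × (ι → ZMod 2) → Bool,
        ∀ b ∈ D, ∀ a a', cyclicRel τ a a' b →
          (key a < key a' ∧ c b a = false ∧ c b a' = true) ∨
          (key a' < key a ∧ c b a' = false ∧ c b a = true) := by
  classical
  have : Fact (1 < 2 * k + 1) := ⟨by omega⟩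
  obtain ⟨w, hw⟩ : ∃ w, w ∉ D.image Prod.fst ∪ D.image fun b => b.1 + 1 := by
    by_contra! h
    have h₁ := Finset.card_le_card (fun w _ => h w : Finset.univ ⊆ _)
    have h₂ := Finset.card_union_le (D.image Prod.fst) (D.image fun b => b.1 + 1)
    have h₃ := Finset.card_image_le (s := D) (f := Prod.fst)
    have h₄ := Finset.card_image_le (s := D) (f := fun b => b.1 + 1)
    rw [Finset.card_univ, ZMod.card] at h₁
    omega
  simp only [Finset.mem_union, Finset.mem_image, not_or, not_exists, not_and] at hw
  refine ⟨fun a => toLex ((a.1 - w).val, τ a.2), fun a a' h => ?_,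
    fun b a => if a.1 = b.1 then decide (dotProduct a.2 b.2 = 1)
      else decide ((2 * b.1 - a.1 - w).val < (a.1 - w).val), ?_⟩
  · have h' := toLex.injective h
    simp only [Prod.mk.injEq] at h'
    exact Prod.ext (sub_left_injective (ZMod.val_injective _ h'.1)) (hτ h'.2)
  rintro ⟨r, y⟩ hb ⟨s, u⟩ ⟨t, v⟩ h
  have hr₀ : (r - 1 - w).val < (r - w).val := by
    have := ZMod.val_sub_one_lt (sub_ne_zero.2 (hw.1 _ hb))
    rwa [sub_right_comm] at this
  have hr₁ : (r - w).val < (r + 1 - w).val := by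
    have := ZMod.val_sub_one_lt (sub_ne_zero.2 (hw.2 _ hb))
    rwa [sub_right_comm, add_sub_cancel_right] at this
  rcases h with ⟨hne, hsum⟩ | ⟨hs, ht, hlt, hu, hv⟩ | ⟨hs, ht, hv⟩ | ⟨hs, ht, hu⟩
  · dsimp only at hne hsum
    have hsr : s ≠ r := by
      rintro rfl
      exact hne (by linear_combination -hsum)
    have htr : t ≠ r := by
      rintro rfl
      exact hne (by linear_combination hsum)
    have e₁ : 2 * r - s = t := by linear_combination -hsum
    have e₂ : 2 * r - t = s := by linear_combination -hsum
    have hval : (s - w).val ≠ (t - w).val := fun h =>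
      hne (sub_left_injective (ZMod.val_injective _ h))
    rcases hval.lt_or_gt with h | h
    · left
      simp [hsr, htr, e₁, e₂, h, h.le, Prod.Lex.toLex_lt_toLex]
    · right
      simp [hsr, htr, e₁, e₂, h, h.le, Prod.Lex.toLex_lt_toLex]
  · dsimp only at hs ht hlt hu hv
    subst hs ht
    left
    simp [hlt, hu, hv, Prod.Lex.toLex_lt_toLex]
  · dsimp only at hs ht hv
    subst hs ht
    left
    have e : 2 * t - (t - 1) = t + 1 := by ring
    simp [hv, hr₀, e, (hr₀.trans hr₁).le, Prod.Lex.toLex_lt_toLex]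
  · dsimp only at hs ht hu
    subst hs ht
    left
    have e : 2 * s - (s + 1) = s - 1 := by ring
    simp [hu, hr₁, e, hr₀.trans hr₁, Prod.Lex.toLex_lt_toLex]

theorem exists_cyclicRel_left_left [DecidableEq ι] {k : ℕ} (hτ : Function.Injective τ)
    (hτ₀ : ∀ u, τ 0 ≤ τ u) {a a' : ZMod (2 * k + 1) × (ι → ZMod 2)} (h : a ≠ a') :
    ∃ D : Finset (ZMod (2 * k + 1) × (ι → ZMod 2)), 2 ^ Fintype.card ι ≤ 4 * D.card ∧
      ∀ b ∈ D, cyclicRel τ a a' b ∨ cyclicRel τ a' a b := by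
  by_cases hs : a.1 = a'.1
  · have hu : a.2 ≠ a'.2 := fun hu => h (Prod.ext hs hu)
    wlog hlt : τ a.2 < τ a'.2 generalizing a a'
    · obtain ⟨D, hD, hD'⟩ := this h.symm hs.symm hu.symm
        ((hτ.ne hu).lt_or_gt.resolve_left hlt)
      exact ⟨D, hD, fun b hb => (hD' b hb).symm⟩
    have hv : a'.2 ≠ 0 := fun hv => (hτ₀ a.2).not_gt (hv ▸ hlt)
    refine ⟨(Finset.univ.filter fun y => dotProduct a.2 y = 0 ∧ dotProduct a'.2 y = 1).image
      (Prod.mk a.1), ?_, fun b hb => ?_⟩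
    · rw [Finset.card_image_of_injective _ (Prod.mk_right_injective _)]
      exact two_pow_card_le_four_mul_card_dotProduct hv hu
    · obtain ⟨y, hy, rfl⟩ := Finset.mem_image.1 hb
      have := (Finset.mem_filter.1 hy).2
      exact .inl (.inr (.inl ⟨rfl, hs.symm, hlt, this⟩))
  · refine ⟨Finset.univ.image (Prod.mk ((a.1 + a'.1) * (k + 1))), ?_, fun b hb => ?_⟩
    · rw [Finset.card_image_of_injective _ (Prod.mk_right_injective _), Finset.card_univ,
        Fintype.card_fun, ZMod.card]
      omega
    · obtain ⟨y, -, rfl⟩ := Finset.mem_image.1 hb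
      have hk : (2 * k + 1 : ZMod (2 * k + 1)) = 0 := by
        exact_mod_cast ZMod.natCast_self (2 * k + 1)
      exact .inl (.inl ⟨hs, by linear_combination (-(a.1 + a'.1)) * hk⟩)

theorem exists_cyclicRel_left_right [DecidableEq ι] {k : ℕ}
    (a b : ZMod (2 * k + 1) × (ι → ZMod 2)) :
    ∃ D : Finset (ZMod (2 * k + 1) × (ι → ZMod 2)), 2 ^ Fintype.card ι ≤ 4 * D.card ∧
      ∀ a' ∈ D, cyclicRel τ a a' b ∨ cyclicRel τ a' a b := by
  obtain ⟨t, ht⟩ : ∃ t, ∀ v, cyclicRel τ a (t, v) b ∨ cyclicRel τ (t, v) a b := by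
    by_cases hs : a.1 = b.1
    · rcases ZMod.two_eq_zero_or_one (dotProduct a.2 b.2) with h | h
      · exact ⟨b.1 + 1, fun v => .inl (.inr (.inr (.inr ⟨hs, rfl, h⟩)))⟩
      · exact ⟨b.1 - 1, fun v => .inr (.inr (.inr (.inl ⟨rfl, hs, h⟩)))⟩
    · refine ⟨2 * b.1 - a.1, fun v => .inl (.inl ⟨fun h => hs ?_, by ring⟩)⟩
      have hk : (2 * k + 1 : ZMod (2 * k + 1)) = 0 := by
        exact_mod_cast ZMod.natCast_self (2 * k + 1)
      dsimp only at h
      linear_combination (k + 1 : ZMod (2 * k + 1)) * h + (b.1 - a.1) * hk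
  refine ⟨Finset.univ.image (Prod.mk t), ?_, fun a' ha' => ?_⟩
  · rw [Finset.card_image_of_injective _ (Prod.mk_right_injective _), Finset.card_univ,
      Fintype.card_fun, ZMod.card]
    omega
  · obtain ⟨v, -, rfl⟩ := Finset.mem_image.1 ha'
    exact ht v

end Construction

/-- For every `k ≥ 1` there is `ε > 0` such that for infinitely many `n` there
is a `(2,1)`-type 3-graph `H` w.r.t. a partition `A ∪ B` with `|A| = |B| = n`
such that: (C1) every pair of distinct vertices of `A` has codegree at least
`ε n`; (C2) every pair `(a, b) ∈ A × B` has codegree at least `ε n`; (C3) `H`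
contains no copy of any 3-graph `F` with at most `k` vertices and
`π_⋅(F) > 0`. -/
theorem stmt8 (k : ℕ) (hk : 0 < k) :
    ∃ ε : ℝ, 0 < ε ∧
      ∀ N : ℕ, ∃ n, N ≤ n ∧
        ∃ H : H3 (Fin (2 * n)), ∃ A B : Finset (Fin (2 * n)),
          Disjoint A B ∧ A ∪ B = Finset.univ ∧ A.card = n ∧ B.card = n ∧
          (∀ e ∈ H.edges, (e ∩ A).card = 2 ∧ (e ∩ B).card = 1) ∧
          (∀ a₁ ∈ A, ∀ a₂ ∈ A, a₁ ≠ a₂ → ε * n ≤ (H.codeg a₁ a₂ : ℝ)) ∧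
          (∀ a ∈ A, ∀ b ∈ B, ε * n ≤ (H.codeg a b : ℝ)) ∧
          (∀ (W : Type) [DecidableEq W] [Fintype W], Fintype.card W ≤ k →
            ∀ F : H3 W, 0 < uniformTuranDensity F → H.free F) := by
  classical
  have : Fact (1 < 2 * k + 1) := ⟨by omega⟩
  refine ⟨1 / (4 * (2 * k + 1)), by positivity, fun N => ?_⟩
  let T := Fin N → ZMod 2
  let X := ZMod (2 * k + 1) × T
  have hX : Fintype.card X = (2 * k + 1) * 2 ^ N := by
    simp [X, T, Fintype.card_prod, ZMod.card]
  set n := (2 * k + 1) * 2 ^ N with hn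
  have hN : N ≤ n := (Nat.lt_two_pow_self).le.trans (Nat.le_mul_of_pos_left _ (by omega))
  let φ : X ⊕ X ≃ Fin (2 * n) := Fintype.equivFinOfCardEq (by rw [Fintype.card_sum, hX, two_mul])
  let τ : T → ℕ := fun u => if u = 0 then 0 else Fintype.equivFin T u + 1
  have hτ : Function.Injective τ := by
    intro u v h
    by_cases hu : u = 0 <;> by_cases hv : v = 0 <;> simp [τ, hu, hv, Fin.val_inj] at h ⊢
    exact h
  have hτ₀ : ∀ u, τ 0 ≤ τ u := fun u => by simp [τ]
  have hR : ∀ a a' b : X, cyclicRel τ a a' b → a ≠ a' := fun _ _ _ h => h.ne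
  have hε : ∀ c d : ℕ, 2 ^ Fintype.card (Fin N) ≤ 4 * c → c ≤ d →
      1 / (4 * (2 * k + 1)) * (n : ℝ) ≤ d := by
    intro c d hc hcd
    have : (2 : ℝ) ^ N ≤ 4 * d := by
      rw [Fintype.card_fin] at hc
      exact_mod_cast hc.trans (Nat.mul_le_mul_left 4 hcd)
    rw [hn]
    push_cast
    rw [div_mul_eq_mul_div, one_mul, div_le_iff₀ (by positivity)]
    have hk' : (0 : ℝ) ≤ 2 * k + 1 := by positivity
    nlinarith [mul_le_mul_of_nonneg_left this hk']
  refine ⟨n, hN, twoOneGraph φ (cyclicRel τ) hR, Finset.univ.image fun a => φ (.inl a),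
    Finset.univ.image fun b => φ (.inr b), ?_, ?_, ?_, ?_, ?_, ?_, ?_, ?_⟩
  · simp [Finset.disjoint_left]
  · ext x
    obtain ⟨a | b, rfl⟩ := φ.surjective x <;> simp
  · exact (Finset.card_image_of_injective _ (φ.injective.comp Sum.inl_injective)).trans hX
  · exact (Finset.card_image_of_injective _ (φ.injective.comp Sum.inr_injective)).trans hX
  · intro e he
    obtain ⟨a, a', b, h, rfl⟩ := mem_twoOneGraph.1 he
    have hne := hR _ _ _ h
    constructor
    · refine Finset.card_eq_two.2 ⟨φ (.inl a), φ (.inl a'), by simpa using hne, ?_⟩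
      ext x
      obtain ⟨x | x, rfl⟩ := φ.surjective x <;> simp
    · refine Finset.card_eq_one.2 ⟨φ (.inr b), ?_⟩
      ext x
      obtain ⟨x | x, rfl⟩ := φ.surjective x <;> simp
  · intro x hx y hy hxy
    obtain ⟨a, -, rfl⟩ := Finset.mem_image.1 hx
    obtain ⟨a', -, rfl⟩ := Finset.mem_image.1 hy
    obtain ⟨D, hD, hD'⟩ := exists_cyclicRel_left_left hτ hτ₀
      (show a ≠ a' from fun h => hxy (by rw [h]))
    exact hε _ _ hD (card_le_codeg_inl_inl hD')
  · intro x hx y hy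
    obtain ⟨a, -, rfl⟩ := Finset.mem_image.1 hx
    obtain ⟨b, -, rfl⟩ := Finset.mem_image.1 hy
    obtain ⟨D, hD, hD'⟩ := exists_cyclicRel_left_right (τ := τ) a b
    exact hε _ _ hD (card_le_codeg_inl_inr hD')
  · intro W _ _ hW F hF
    exact twoOneGraph_free (cyclicRel.exists_key_colouring hk hτ) W hW F hF
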